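/- arXiv:math/0506587 — 2 statements merged into one kernel-verified Lean document; each statement's English description precedes it below -/
import Mathlib

section
/- There exists a universal constant Θ ∈ (0,∞) with the following property. Let n ≥ 3, R > 0, and let X ∈ C²(B,ℝⁿ) ∩ C⁰(B̄,ℝⁿ) be a conformally parametrized minimal surface graph over B_R, i.e.: X is harmonic (ΔX = 0 in B); |X_u|² = |X_v|² = W and X_u·X_v = 0 with W > 0 in B; the plane mapping F*(u,v) := (x¹(u,v), x²(u,v)) formed by the first two components of X maps B̄ one-to-one onto B̄_R with positive Jacobian in B, satisfies F*(0,0) = (0,0), and maps ∂B topologically onto ∂B_R. Then for every differentiable unit normal field N along X, the principal curvatures in direction N satisfy κ_{N,1}(0,0)² + κ_{N,2}(0,0)² ≤ Θ·‖X‖²_{C⁰(B)} / R⁴. -/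
open scoped RealInnerProductSpace

/-- First partial derivative (w.r.t. the first variable `u`). -/
noncomputable def pd1 {E : Type*} [NormedAddCommGroup E] [NormedSpace ℝ E]
    (f : ℝ × ℝ → E) (p : ℝ × ℝ) : E := fderiv ℝ f p (1, 0)

/-- Second partial derivative (w.r.t. the second variable `v`). -/
noncomputable def pd2 {E : Type*} [NormedAddCommGroup E] [NormedSpace ℝ E]
    (f : ℝ × ℝ → E) (p : ℝ × ℝ) : E := fderiv ℝ f p (0, 1)

/-- The open unit disc `B = {(u,v) : u² + v² < 1}`. -/
def unitB : Set (ℝ × ℝ) := {p | p.1 ^ 2 + p.2 ^ 2 < 1}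

/-- The open disc `B_R = {(x,y) : x² + y² < R²}`. -/
def diskR (R : ℝ) : Set (ℝ × ℝ) := {p | p.1 ^ 2 + p.2 ^ 2 < R ^ 2}

/-- The circle `∂B_R = {(x,y) : x² + y² = R²}`. -/
def circleR (R : ℝ) : Set (ℝ × ℝ) := {p | p.1 ^ 2 + p.2 ^ 2 = R ^ 2}

section

open Metric Filter Topology InnerProductSpace

theorem second_deriv_nonpos_of_isLocalMax {g g' : ℝ → ℝ} {c x : ℝ} (hmax : IsLocalMax g x)
    (hg : ∀ᶠ t in 𝓝 x, HasDerivAt g (g' t) t) (hg' : HasDerivAt g' c x) : c ≤ 0 := by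
  by_contra! hc
  have hd : deriv g =ᶠ[𝓝 x] g' := hg.mono fun t ht => ht.deriv
  have hdd : deriv (deriv g) x = c := by rw [hd.deriv_eq, hg'.deriv]
  have hmin : IsLocalMin g x := isLocalMin_of_deriv_deriv_pos (by rwa [hdd]) hmax.deriv_eq_zero
    hg.self_of_nhds.continuousAt
  have hconst : g =ᶠ[𝓝 x] fun _ => g x := by
    filter_upwards [hmax, hmin] with t h₁ h₂ using le_antisymm h₁ h₂
  have h0 : deriv g =ᶠ[𝓝 x] fun _ => 0 := by
    simpa using hconst.deriv
  rw [h0.deriv_eq, deriv_const] at hdd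
  exact hc.ne hdd

theorem hasDerivAt_logDeriv_of_pos {P P₁ : ℝ → ℝ} {P₂ x : ℝ}
    (hP : ∀ᶠ t in 𝓝 x, HasDerivAt P (P₁ t) t) (hP₁ : HasDerivAt P₁ P₂ x) (h0 : 0 < P x) :
    (∀ᶠ t in 𝓝 x, HasDerivAt (fun s => Real.log (P s)) (P₁ t / P t) t) ∧
      HasDerivAt (fun t => P₁ t / P t) (P₂ / P x - (P₁ x / P x) ^ 2) x := by
  constructor
  · filter_upwards [hP, hP.self_of_nhds.continuousAt.eventually (lt_mem_nhds h0)] with t ht hp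
    exact ht.log (ne_of_gt hp)
  · refine (hP₁.div hP.self_of_nhds h0.ne').congr_deriv ?_
    field_simp

theorem log_second_deriv_le_of_isLocalMax {A A₁ P P₁ D D₁ : ℝ → ℝ} {A₂ P₂ D₂ x : ℝ}
    (hA : ∀ᶠ t in 𝓝 x, HasDerivAt A (A₁ t) t) (hA₁ : HasDerivAt A₁ A₂ x) (hA0 : 0 < A x)
    (hP : ∀ᶠ t in 𝓝 x, HasDerivAt P (P₁ t) t) (hP₁ : HasDerivAt P₁ P₂ x) (hP0 : 0 < P x)
    (hD : ∀ᶠ t in 𝓝 x, HasDerivAt D (D₁ t) t) (hD₁ : HasDerivAt D₁ D₂ x) (hD0 : 0 < D x)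
    (hmax : IsLocalMax
      (fun t => 2 * Real.log (A t) - Real.log (P t) - 2 * Real.log (D t)) x) :
    2 * (A₂ / A x - (A₁ x / A x) ^ 2) - (P₂ / P x - (P₁ x / P x) ^ 2)
      - 2 * (D₂ / D x - (D₁ x / D x) ^ 2) ≤ 0 := by
  obtain ⟨a, a'⟩ := hasDerivAt_logDeriv_of_pos hA hA₁ hA0
  obtain ⟨p, p'⟩ := hasDerivAt_logDeriv_of_pos hP hP₁ hP0
  obtain ⟨d, d'⟩ := hasDerivAt_logDeriv_of_pos hD hD₁ hD0
  refine second_deriv_nonpos_of_isLocalMax hmax ?_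
    (((a'.const_mul 2).sub p').sub (d'.const_mul 2))
  filter_upwards [a, p, d] with t ha hp hd using ((ha.const_mul 2).sub hp).sub (hd.const_mul 2)

theorem hasDerivAt_re_comp_line {F : ℂ → ℂ} {z e : ℂ} {t : ℝ}
    (hF : DifferentiableAt ℂ F (z + t * e)) :
    HasDerivAt (fun s : ℝ => (F (z + s * e)).re) (e * deriv F (z + t * e)).re t := by
  have h1 : HasDerivAt (fun s : ℂ => z + s * e) e (t : ℂ) := by
    simpa using ((hasDerivAt_id (t : ℂ)).mul_const e).const_add z
  have h2 := (HasDerivAt.comp (t : ℂ) hF.hasDerivAt h1).real_of_complex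
  rw [mul_comm] at h2
  exact h2

theorem hasDerivAt_sq_re_add_sq_re {F G : ℂ → ℂ} {U : Set ℂ} (hU : IsOpen U)
    (hF : DifferentiableOn ℂ F U) (hG : DifferentiableOn ℂ G U) {z : ℂ} (hz : z ∈ U) (e : ℂ) :
    ∃ P₁ : ℝ → ℝ,
      (∀ᶠ t : ℝ in 𝓝 0, HasDerivAt
        (fun s : ℝ => (F (z + s * e)).re ^ 2 + (G (z + s * e)).re ^ 2) (P₁ t) t) ∧
      P₁ 0 = 2 * ((F z).re * (e * deriv F z).re + (G z).re * (e * deriv G z).re) ∧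
      HasDerivAt P₁ (2 * ((e * deriv F z).re ^ 2 + (F z).re * (e * (e * deriv (deriv F) z)).re
        + (e * deriv G z).re ^ 2 + (G z).re * (e * (e * deriv (deriv G) z)).re)) 0 := by
  have key : ∀ {H : ℂ → ℂ}, DifferentiableOn ℂ H U →
      (∀ᶠ t : ℝ in 𝓝 0, HasDerivAt (fun s : ℝ => (H (z + s * e)).re)
        (e * deriv H (z + t * e)).re t) ∧
      HasDerivAt (fun t : ℝ => (e * deriv H (z + t * e)).re)
        (e * (e * deriv (deriv H) z)).re 0 := by
    intro H hH
    have hc : ∀ᶠ t : ℝ in 𝓝 0, z + t * e ∈ U := by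
      have : ContinuousAt (fun t : ℝ => z + t * e) 0 := by fun_prop
      exact this (hU.mem_nhds (by simpa using hz))
    constructor
    · filter_upwards [hc] with t ht
      exact hasDerivAt_re_comp_line (hH.differentiableAt (hU.mem_nhds ht))
    · have hd : DifferentiableAt ℂ (deriv H) z := (hH.deriv hU).differentiableAt (hU.mem_nhds hz)
      have h := hasDerivAt_re_comp_line (F := fun w => e * deriv H w) (z := z) (e := e) (t := 0)
        (by simpa using hd.const_mul e)
      simpa [deriv_const_mul_field] using h
  obtain ⟨f, f'⟩ := key hF
  obtain ⟨g, g'⟩ := key hG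
  refine ⟨fun t => 2 * ((F (z + t * e)).re * (e * deriv F (z + t * e)).re
    + (G (z + t * e)).re * (e * deriv G (z + t * e)).re), ?_, by simp, ?_⟩
  · filter_upwards [f, g] with t hf hg
    refine ((hf.pow 2).add (hg.pow 2)).congr_deriv ?_
    push_cast
    ring
  · refine (((f.self_of_nhds.mul f').add (g.self_of_nhds.mul g')).const_mul 2).congr_deriv ?_
    simp only [Complex.ofReal_zero, zero_mul, add_zero]
    ring

/-- Second order condition at an interior maximum of
`(r² - |f|²)² / (‖F' + I G'‖² (1 - ‖z‖²)²)`, where `f = (Re F, Re G)`. -/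
theorem sq_le_of_isLocalMax {F G : ℂ → ℂ} (hF : DifferentiableOn ℂ F (ball 0 1))
    (hG : DifferentiableOn ℂ G (ball 0 1)) {r : ℝ} {z : ℂ} (hz : z ∈ ball (0 : ℂ) 1)
    (hk0 : deriv F z + Complex.I * deriv G z ≠ 0)
    (hk : ‖deriv F z‖ ^ 2 + ‖deriv G z‖ ^ 2 ≤ ‖deriv F z + Complex.I * deriv G z‖ ^ 2)
    (hA : (F z).re ^ 2 + (G z).re ^ 2 < r ^ 2)
    (hmax : IsLocalMax (fun w => 2 * Real.log (r ^ 2 - ((F w).re ^ 2 + (G w).re ^ 2))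
      - Real.log (‖deriv F w + Complex.I * deriv G w‖ ^ 2) - 2 * Real.log (1 - ‖w‖ ^ 2)) z) :
    (r ^ 2 - ((F z).re ^ 2 + (G z).re ^ 2)) ^ 2 ≤
      r ^ 2 * (‖deriv F z + Complex.I * deriv G z‖ ^ 2 * (1 - ‖z‖ ^ 2) ^ 2) := by
  set k : ℂ → ℂ := fun w => deriv F w + Complex.I * deriv G w
  have hkd : DifferentiableOn ℂ k (ball 0 1) :=
    (hF.deriv isOpen_ball).add ((hG.deriv isOpen_ball).const_mul _)
  have hzn : ‖z‖ ^ 2 < 1 := by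
    have : ‖z‖ < 1 := by simpa using hz
    nlinarith [norm_nonneg z]
  have hkz : 0 < ‖k z‖ ^ 2 := by positivity
  have hzz : ∀ w : ℂ, ‖w‖ ^ 2 = w.re ^ 2 + (-Complex.I * w).re ^ 2 := by
    intro w
    rw [Complex.sq_norm, Complex.normSq_apply]
    simp
    ring
  have main : ∀ e : ℂ,
      2 * (-(2 * ((e * deriv F z).re ^ 2 + (F z).re * (e * (e * deriv (deriv F) z)).re
          + (e * deriv G z).re ^ 2 + (G z).re * (e * (e * deriv (deriv G) z)).re))
            / (r ^ 2 - ((F z).re ^ 2 + (G z).re ^ 2))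
        - (-(2 * ((F z).re * (e * deriv F z).re + (G z).re * (e * deriv G z).re))
            / (r ^ 2 - ((F z).re ^ 2 + (G z).re ^ 2))) ^ 2)
      - (2 * ((e * deriv k z).re ^ 2 + (k z).re * (e * (e * deriv (deriv k) z)).re
          + (e * (-Complex.I * deriv k z)).re ^ 2
          + (-Complex.I * k z).re * (e * (e * (-Complex.I * deriv (deriv k) z))).re) / ‖k z‖ ^ 2
        - (2 * ((k z).re * (e * deriv k z).re
          + (-Complex.I * k z).re * (e * (-Complex.I * deriv k z)).re) / ‖k z‖ ^ 2) ^ 2)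
      - 2 * (-(2 * (e.re ^ 2 + (e * -Complex.I).re ^ 2)) / (1 - ‖z‖ ^ 2)
        - (-(2 * (z.re * e.re + (-Complex.I * z).re * (e * -Complex.I).re)) / (1 - ‖z‖ ^ 2)) ^ 2)
      ≤ 0 := by
    intro e
    obtain ⟨A₁, hA', hA10, hA₁⟩ := hasDerivAt_sq_re_add_sq_re isOpen_ball hF hG hz e
    obtain ⟨P₁, hP, hP10, hP₁⟩ := hasDerivAt_sq_re_add_sq_re isOpen_ball hkd
      (hkd.const_mul (-Complex.I)) hz e
    obtain ⟨D₁, hD, hD10, hD₁⟩ := hasDerivAt_sq_re_add_sq_re (U := ball 0 1) isOpen_ball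
      (F := fun w => w) (G := fun w => -Complex.I * w)
      differentiableOn_id (differentiableOn_id.const_mul (-Complex.I)) hz e
    have hm : IsLocalMax (fun t : ℝ => 2 * Real.log
          (r ^ 2 - ((F (z + t * e)).re ^ 2 + (G (z + t * e)).re ^ 2))
        - Real.log ((k (z + t * e)).re ^ 2 + (-Complex.I * k (z + t * e)).re ^ 2)
        - 2 * Real.log (1 - ((z + t * e).re ^ 2 + (-Complex.I * (z + t * e)).re ^ 2))) 0 := by
      have hc : ContinuousAt (fun t : ℝ => z + t * e) 0 := by fun_prop
      have ht : Tendsto (fun t : ℝ => z + t * e) (𝓝 0) (𝓝 z) := by simpa using hc.tendsto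
      have := ht.eventually hmax
      simp only [← hzz]
      filter_upwards [this] with t ht
      simpa using ht
    have hD' : 0 < 1 - (z.re ^ 2 + (-Complex.I * z).re ^ 2) := by
      rw [← hzz]; linarith
    have := log_second_deriv_le_of_isLocalMax
      (hA'.mono fun t ht => ht.const_sub (r ^ 2)) hA₁.neg (by simpa using hA)
      hP hP₁ (by rw [← hzz]; simpa using hkz)
      (hD.mono fun t ht => ht.const_sub 1) hD₁.neg (by simpa using hD') hm
    rw [hA10, hP10, hD10] at this
    have hdi : deriv (fun w : ℂ => -Complex.I * w) = fun _ => -Complex.I := by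
      ext w; simp
    simpa only [hzz, Complex.ofReal_zero, zero_mul, add_zero, deriv_const_mul_field', hdi, deriv_id'',
      deriv_const', mul_zero, mul_one, Complex.zero_re] using this
  have h1 := main 1
  have h2 := main Complex.I
  have hkk : (k z).re ^ 2 + (k z).im ^ 2 = ‖k z‖ ^ 2 := by
    rw [Complex.sq_norm, Complex.normSq_apply]; ring
  have hzz' : z.re ^ 2 + z.im ^ 2 = ‖z‖ ^ 2 := by
    rw [Complex.sq_norm, Complex.normSq_apply]; ring
  have hff : (deriv F z).re ^ 2 + (deriv F z).im ^ 2 = ‖deriv F z‖ ^ 2 := by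
    rw [Complex.sq_norm, Complex.normSq_apply]; ring
  have hgg : (deriv G z).re ^ 2 + (deriv G z).im ^ 2 = ‖deriv G z‖ ^ 2 := by
    rw [Complex.sq_norm, Complex.normSq_apply]; ring
  change ‖deriv F z‖ ^ 2 + ‖deriv G z‖ ^ 2 ≤ ‖k z‖ ^ 2 at hk
  change _ ≤ r ^ 2 * (‖k z‖ ^ 2 * (1 - ‖z‖ ^ 2) ^ 2)
  simp only [neg_mul, Complex.mul_re, Complex.mul_im, Complex.neg_re, Complex.neg_im, Complex.I_re, Complex.I_im,
    Complex.one_re, zero_mul, one_mul, mul_zero, zero_sub, neg_neg, mul_one,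
    zero_add] at h1 h2
  generalize ‖k z‖ ^ 2 = K at *
  generalize ‖z‖ ^ 2 = Z at *
  generalize (k z).re = k1 at *
  generalize (k z).im = k2 at *
  generalize (deriv k z).re = l1 at *
  generalize (deriv k z).im = l2 at *
  generalize (deriv (deriv k) z).re = m1 at *
  generalize (deriv (deriv k) z).im = m2 at *
  generalize (deriv F z).re = f1 at *
  generalize (deriv F z).im = f2 at *
  generalize (deriv G z).re = g1 at *
  generalize (deriv G z).im = g2 at *
  generalize (F z).re = x at *
  generalize (G z).re = y at *
  generalize (deriv (deriv F) z).re = x2 at *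
  generalize (deriv (deriv G) z).re = y2 at *
  generalize z.re = a at *
  generalize z.im = b at *
  subst hkk hzz'
  have h3 : 8 / (1 - (a ^ 2 + b ^ 2)) ^ 2
      - 4 * (f1 ^ 2 + f2 ^ 2 + (g1 ^ 2 + g2 ^ 2)) / (r ^ 2 - (x ^ 2 + y ^ 2))
      - 8 * ((x * f1 + y * g1) ^ 2 + (x * f2 + y * g2) ^ 2) / (r ^ 2 - (x ^ 2 + y ^ 2)) ^ 2 ≤ 0 := by
    refine le_trans (le_of_eq ?_) (add_nonpos h1 h2)
    have hD0 : 1 - (a ^ 2 + b ^ 2) ≠ 0 := by linarith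
    have hA0 : r ^ 2 - (x ^ 2 + y ^ 2) ≠ 0 := by linarith
    have hK0 := hkz.ne'
    field_simp
    ring
  rw [← hff, ← hgg] at hk
  have hA' : 0 < r ^ 2 - (x ^ 2 + y ^ 2) := by linarith
  have hD' : 0 < 1 - (a ^ 2 + b ^ 2) := by linarith
  have hx : r ^ 2 = (r ^ 2 - (x ^ 2 + y ^ 2)) + (x ^ 2 + y ^ 2) := by ring
  generalize r ^ 2 - (x ^ 2 + y ^ 2) = A at *
  generalize 1 - (a ^ 2 + b ^ 2) = D at *
  generalize k1 ^ 2 + k2 ^ 2 = K at *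
  rw [hx]
  have h4 : 8 * A ^ 2 ≤ D ^ 2 * (4 * (f1 ^ 2 + f2 ^ 2 + (g1 ^ 2 + g2 ^ 2)) * A
      + 8 * ((x * f1 + y * g1) ^ 2 + (x * f2 + y * g2) ^ 2)) := by
    field_simp at h3
    nlinarith
  have h5 : 4 * (f1 ^ 2 + f2 ^ 2 + (g1 ^ 2 + g2 ^ 2)) * A
      + 8 * ((x * f1 + y * g1) ^ 2 + (x * f2 + y * g2) ^ 2) ≤ 8 * ((A + (x ^ 2 + y ^ 2)) * K) := by
    have c1 : (x * f1 + y * g1) ^ 2 + (x * f2 + y * g2) ^ 2 ≤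
        (x ^ 2 + y ^ 2) * (f1 ^ 2 + f2 ^ 2 + (g1 ^ 2 + g2 ^ 2)) := by
      nlinarith [sq_nonneg (x * g1 - y * f1), sq_nonneg (x * g2 - y * f2)]
    have c2 := mul_le_mul_of_nonneg_left hk (by positivity : 0 ≤ A + (x ^ 2 + y ^ 2))
    have c3 : 0 ≤ A * (f1 ^ 2 + f2 ^ 2 + (g1 ^ 2 + g2 ^ 2)) := by positivity
    linarith
  have h6 := mul_le_mul_of_nonneg_left h5 (sq_nonneg D)
  linarith

/-- If `f = (Re F, Re G)` is a sense preserving harmonic map of the unit disc fixing the origin such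
that the preimage of the closed disc of radius `r` is compact, then `‖F' + I G'‖ ≥ r` at the origin.
This follows from the maximum principle, comparing a conformal metric with the Poincaré metric. -/
theorem norm_deriv_ge_of_compact_preimage {F G : ℂ → ℂ} (hF : DifferentiableOn ℂ F (ball 0 1))
    (hG : DifferentiableOn ℂ G (ball 0 1)) {r : ℝ} (hr : 0 < r) {K : Set ℂ} (hK : IsCompact K)
    (hKB : K ⊆ ball 0 1)
    (hFK : ∀ z ∈ ball (0 : ℂ) 1, (F z).re ^ 2 + (G z).re ^ 2 ≤ r ^ 2 → z ∈ K)
    (hF0 : (F 0).re = 0) (hG0 : (G 0).re = 0)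
    (hk0 : ∀ z ∈ ball (0 : ℂ) 1, deriv F z + Complex.I * deriv G z ≠ 0)
    (hk : ∀ z ∈ ball (0 : ℂ) 1,
      ‖deriv F z‖ ^ 2 + ‖deriv G z‖ ^ 2 ≤ ‖deriv F z + Complex.I * deriv G z‖ ^ 2) :
    r ^ 2 ≤ ‖deriv F 0 + Complex.I * deriv G 0‖ ^ 2 := by
  set k : ℂ → ℂ := fun w => deriv F w + Complex.I * deriv G w
  have hkd : DifferentiableOn ℂ k (ball 0 1) :=
    (hF.deriv isOpen_ball).add ((hG.deriv isOpen_ball).const_mul _)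
  set f : ℂ → ℝ := fun w => (F w).re ^ 2 + (G w).re ^ 2 with hf
  have hfc : ContinuousOn f (ball 0 1) :=
    ((Complex.continuous_re.comp_continuousOn hF.continuousOn).pow 2).add
      ((Complex.continuous_re.comp_continuousOn hG.continuousOn).pow 2)
  have hzn : ∀ z ∈ ball (0 : ℂ) 1, 0 < 1 - ‖z‖ ^ 2 := by
    intro z hz
    have : ‖z‖ < 1 := by simpa using hz
    nlinarith [norm_nonneg z]
  have hkp : ∀ z ∈ ball (0 : ℂ) 1, 0 < ‖k z‖ ^ 2 := fun z hz => by
    have := norm_pos_iff.2 (hk0 z hz)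
    positivity
  have h0 : (0 : ℂ) ∈ ball (0 : ℂ) 1 := by simp
  have hf0 : f 0 = 0 := by simp [hf, hF0, hG0]
  set Q : ℂ → ℝ := fun z => (r ^ 2 - f z) ^ 2 / (‖k z‖ ^ 2 * (1 - ‖z‖ ^ 2) ^ 2) with hQ
  have hden : ∀ z ∈ ball (0 : ℂ) 1, 0 < ‖k z‖ ^ 2 * (1 - ‖z‖ ^ 2) ^ 2 := fun z hz =>
    mul_pos (hkp z hz) (pow_pos (hzn z hz) 2)
  have hQc : ContinuousOn Q (ball 0 1) :=
    ((continuousOn_const.sub hfc).pow 2).div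
      ((hkd.continuousOn.norm.pow 2).mul (by fun_prop)) fun z hz => (hden z hz).ne'
  have hS : IsCompact (K ∩ f ⁻¹' Set.Iic (r ^ 2)) :=
    hK.of_isClosed_subset ((hfc.mono hKB).preimage_isClosed_of_isClosed hK.isClosed isClosed_Iic)
      Set.inter_subset_left
  have h0S : (0 : ℂ) ∈ K ∩ f ⁻¹' Set.Iic (r ^ 2) := by
    have h : f 0 ≤ r ^ 2 := by rw [hf0]; positivity
    exact ⟨hFK 0 h0 h, h⟩
  obtain ⟨z, ⟨hzK, hzr⟩, hzmax⟩ := hS.exists_isMaxOn ⟨0, h0S⟩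
    (hQc.mono (Set.inter_subset_left.trans hKB))
  have hzB := hKB hzK
  have hQ0 : Q 0 = r ^ 4 / ‖k 0‖ ^ 2 := by
    simp only [hQ, hf0]
    simp
    ring
  have hQ0le : Q 0 ≤ Q z := hzmax h0S
  have hk00 := hkp 0 h0
  have hlt : f z < r ^ 2 := by
    refine lt_of_le_of_ne hzr fun h => ?_
    have : Q z = 0 := by simp [hQ, h]
    rw [this, hQ0] at hQ0le
    have : 0 < r ^ 4 / ‖k 0‖ ^ 2 := by positivity
    linarith
  have hloc : IsLocalMax (fun w => 2 * Real.log (r ^ 2 - f w)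
      - Real.log (‖k w‖ ^ 2) - 2 * Real.log (1 - ‖w‖ ^ 2)) z := by
    have hlog : ∀ w ∈ ball (0 : ℂ) 1, f w < r ^ 2 → Real.log (Q w) = 2 * Real.log (r ^ 2 - f w)
        - Real.log (‖k w‖ ^ 2) - 2 * Real.log (1 - ‖w‖ ^ 2) := by
      intro w hw hfw
      have := hzn w hw
      rw [hQ, Real.log_div (pow_ne_zero 2 (by linarith)) (hden w hw).ne',
        Real.log_mul (hkp w hw).ne' (by positivity), Real.log_pow (r ^ 2 - f w),
        Real.log_pow (1 - ‖w‖ ^ 2)]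
      push_cast
      ring
    have hnear : ∀ᶠ w in 𝓝 z, f w < r ^ 2 :=
      (hfc.continuousAt (isOpen_ball.mem_nhds hzB)).eventually (gt_mem_nhds hlt)
    filter_upwards [hnear, isOpen_ball.mem_nhds hzB] with w hfw hw
    rw [← hlog w hw hfw, ← hlog z hzB hlt]
    refine Real.log_le_log (div_pos (pow_pos (by linarith) 2) (hden w hw)) ?_
    exact hzmax ⟨hFK w hw hfw.le, hfw.le⟩
  have hle := sq_le_of_isLocalMax hF hG hzB (hk0 z hzB) (hk z hzB) hlt hloc
  have hQz : Q z ≤ r ^ 2 := (div_le_iff₀ (hden z hzB)).2 hle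
  have := hQ0le.trans hQz
  rw [hQ0, div_le_iff₀ hk00] at this
  change r ^ 2 ≤ ‖k 0‖ ^ 2
  have hr2 : 0 < r ^ 2 := by positivity
  nlinarith

theorem isOpen_unitB : IsOpen unitB :=
  isOpen_lt (by fun_prop) continuous_const

theorem mem_unitB_iff {z : ℂ} : (z.re, z.im) ∈ unitB ↔ z ∈ ball (0 : ℂ) 1 := by
  rw [mem_ball_zero_iff, ← sq_lt_one_iff₀ (norm_nonneg z), Complex.sq_norm, Complex.normSq_apply]
  simp only [unitB, Set.mem_ofPred_eq, sq]

theorem equivRealProdCLM_mem_unitB_iff {z : ℂ} :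
    Complex.equivRealProdCLM z ∈ unitB ↔ z ∈ ball (0 : ℂ) 1 := mem_unitB_iff

theorem contDiffOn_pd1 {E : Type*} [NormedAddCommGroup E] [NormedSpace ℝ E] {X : ℝ × ℝ → E}
    (hX : ContDiffOn ℝ 2 X unitB) : ContDiffOn ℝ 1 (pd1 X) unitB :=
  (hX.fderiv_of_isOpen isOpen_unitB (by norm_num)).clm_apply contDiffOn_const

theorem contDiffOn_pd2 {E : Type*} [NormedAddCommGroup E] [NormedSpace ℝ E] {X : ℝ × ℝ → E}
    (hX : ContDiffOn ℝ 2 X unitB) : ContDiffOn ℝ 1 (pd2 X) unitB :=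
  (hX.fderiv_of_isOpen isOpen_unitB (by norm_num)).clm_apply contDiffOn_const

theorem fderiv_clm_comp_of_mem_unitB {E : Type*} [NormedAddCommGroup E] [NormedSpace ℝ E]
    {Y : ℝ × ℝ → E} (hY : ContDiffOn ℝ 1 Y unitB) (l : E →L[ℝ] ℝ) {p : ℝ × ℝ} (hp : p ∈ unitB)
    (v : ℝ × ℝ) : fderiv ℝ (fun q => l (Y q)) p v = l (fderiv ℝ Y p v) := by
  have hd : DifferentiableAt ℝ Y p :=
    (hY.differentiableOn one_ne_zero).differentiableAt (isOpen_unitB.mem_nhds hp)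
  have := (l.hasFDerivAt.comp p hd.hasFDerivAt).fderiv
  simp only [Function.comp_def] at this
  rw [this]
  rfl

/-- A scalar harmonic function on the unit disc is the real part of a holomorphic function. -/
theorem exists_differentiableOn_re_eq {x : ℝ × ℝ → ℝ} (hx : ContDiffOn ℝ 2 x unitB)
    (hΔ : ∀ p ∈ unitB, pd1 (pd1 x) p + pd2 (pd2 x) p = 0) :
    ∃ F : ℂ → ℂ, DifferentiableOn ℂ F (ball 0 1) ∧
      (∀ z ∈ ball (0 : ℂ) 1, (F z).re = x (z.re, z.im)) ∧
      (∀ z ∈ ball (0 : ℂ) 1, deriv F z = ⟨pd1 x (z.re, z.im), -pd2 x (z.re, z.im)⟩) ∧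
      deriv (deriv F) 0 = ⟨pd1 (pd1 x) (0, 0), -pd1 (pd2 x) (0, 0)⟩ := by
  let e := Complex.equivRealProdCLM
  have hfd : ∀ (y : ℝ × ℝ → ℝ) (z v : ℂ), fderiv ℝ (fun w => y (e w)) z v
      = fderiv ℝ y (e z) (e v) := by
    intro y z v
    have := e.comp_right_fderiv (f := y) (x := z)
    simp only [Function.comp_def] at this
    rw [this]
    rfl
  have he1 : e 1 = (1, 0) := by simp [e]
  have heI : e Complex.I = (0, 1) := by simp [e]
  have hcd : ∀ z ∈ ball (0 : ℂ) 1, ContDiffAt ℝ 2 (fun w => x (e w)) z := by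
    intro z hz
    have : ContDiffAt ℝ 2 x (e z) :=
      hx.contDiffAt (isOpen_unitB.mem_nhds (equivRealProdCLM_mem_unitB_iff.2 hz))
    exact this.comp z e.contDiff.contDiffAt
  have hharm : HarmonicOnNhd (fun w => x (e w)) (ball (0 : ℂ) 1) := by
    intro z hz
    refine ⟨hcd z hz, ?_⟩
    filter_upwards [isOpen_ball.mem_nhds hz] with w hw
    have hdd : DifferentiableAt ℝ (fderiv ℝ (fun w => x (e w))) w :=
      ((hcd w hw).fderiv_right (m := 1) (by norm_num)).differentiableAt one_ne_zero
    have hap : ∀ v, fderiv ℝ (fderiv ℝ (fun w => x (e w))) w v v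
        = fderiv ℝ (fun u => fderiv ℝ (fun w => x (e w)) u v) w v := by
      intro v
      rw [fderiv_clm_apply hdd (by fun_prop)]
      simp
    simp only [laplacian_eq_iteratedFDeriv_complexPlane, iteratedFDeriv_two_apply,
      Matrix.cons_val_zero, Matrix.cons_val_one, Pi.zero_apply, hap]
    simp only [hfd x, he1, heI]
    rw [hfd (fun u => fderiv ℝ x u (1, 0)), hfd (fun u => fderiv ℝ x u (0, 1)), he1, heI]
    exact hΔ _ (equivRealProdCLM_mem_unitB_iff.2 hw)
  obtain ⟨F, hF, hre⟩ := hharm.exists_analyticOnNhd_ball_re_eq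
  have hFd : DifferentiableOn ℂ F (ball 0 1) := hF.differentiableOn
  have hreal : ∀ (H : ℂ → ℂ) (y : ℝ × ℝ → ℝ) (z : ℂ), DifferentiableAt ℂ H z →
      (fun w => (H w).re) =ᶠ[𝓝 z] (fun w => y (e w)) → ∀ v : ℂ,
      fderiv ℝ y (e z) (e v) = (v * deriv H z).re := by
    intro H y z hH hy v
    rw [← hfd, ← hy.fderiv_eq]
    have h1 := hH.hasDerivAt.hasFDerivAt.restrictScalars ℝ
    have h2 := (Complex.reCLM.hasFDerivAt.comp z h1).fderiv
    simp only [Function.comp_def, Complex.reCLM_apply] at h2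
    rw [h2]
    simp
  have hder : ∀ z ∈ ball (0 : ℂ) 1,
      deriv F z = ⟨pd1 x (z.re, z.im), -pd2 x (z.re, z.im)⟩ := by
    intro z hz
    have h := hreal F x z (hFd.differentiableAt (isOpen_ball.mem_nhds hz))
      (hre.eventuallyEq_of_mem (isOpen_ball.mem_nhds hz))
    have h1 := h 1
    have h2 := h Complex.I
    rw [he1] at h1
    rw [heI] at h2
    apply Complex.ext
    · rw [one_mul] at h1
      exact h1.symm
    · change _ = -fderiv ℝ x (e z) (0, 1)
      rw [h2]
      simp
  refine ⟨F, hFd, hre, hder, ?_⟩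
  have h0 : (0 : ℂ) ∈ ball (0 : ℂ) 1 := by simp
  have hd2 : DifferentiableAt ℂ (deriv F) 0 :=
    (hFd.deriv isOpen_ball).differentiableAt (isOpen_ball.mem_nhds h0)
  have e0 : e 0 = (0, 0) := by simp [e]
  have k1 := hreal (deriv F) (pd1 x) 0 hd2 (by
    filter_upwards [isOpen_ball.mem_nhds h0] with z hz
    rw [hder z hz]; rfl) 1
  have k2 := hreal (fun z => Complex.I * deriv F z) (pd2 x) 0 (hd2.const_mul _) (by
    filter_upwards [isOpen_ball.mem_nhds h0] with z hz
    rw [hder z hz]; simp [e]) 1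
  rw [e0, he1] at k1 k2
  apply Complex.ext
  · rw [one_mul] at k1
    exact k1.symm
  · change _ = -fderiv ℝ (pd2 x) (0, 0) (1, 0)
    rw [k2]
    simp

/-- Second derivative bound at the centre for a holomorphic function with bounded real part. -/
theorem norm_deriv_deriv_le_of_abs_re_le {F : ℂ → ℂ} (hF : DifferentiableOn ℂ F (ball 0 1))
    {M : ℝ} (hb : ∀ z ∈ ball (0 : ℂ) 1, |(F z).re| ≤ M) :
    ‖deriv (deriv F) 0‖ ≤ 32 * M := by
  wlog hM : 0 < M generalizing M
  · refine le_of_forall_pos_le_add fun ε hε => ?_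
    have hM0 : 0 ≤ M := (abs_nonneg _).trans (hb 0 (by simp))
    have := this (M := M + ε / 32) (fun z hz => (hb z hz).trans (by linarith)) (by linarith)
    linarith
  have hG : DifferentiableOn ℂ (fun z => F z - F 0) (ball 0 1) := hF.sub_const _
  have h0 : (0 : ℂ) ∈ ball (0 : ℂ) 1 := by simp
  have hmaps : Set.MapsTo (fun z => F z - F 0) (ball (0 : ℂ) 1) {z | z.re ≤ 2 * M} := by
    intro z hz
    have := abs_le.1 (hb z hz)
    have := abs_le.1 (hb 0 h0)
    simp only [Set.mem_ofPred_eq, Complex.sub_re]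
    linarith
  have hsub : closedBall (0 : ℂ) (1 / 2) ⊆ ball 0 1 := closedBall_subset_ball (by norm_num)
  have hbd : ∀ z ∈ sphere (0 : ℂ) (1 / 2), ‖F z - F 0‖ ≤ 4 * M := by
    intro z hz
    have hz' : ‖z‖ = 1 / 2 := by simpa using hz
    have := Complex.borelCaratheodory_zero (f := fun z => F z - F 0) (by positivity) hG hmaps one_pos
      (hsub (sphere_subset_closedBall hz)) (by simp)
    refine this.trans (le_of_eq ?_)
    rw [hz']
    ring
  have := Complex.norm_iteratedDeriv_le_of_forall_mem_sphere_norm_le 2 (by norm_num : (0 : ℝ) < 1 / 2)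
    (f := fun z => F z - F 0) (c := 0) (C := 4 * M)
    ((hG.mono (by rw [closure_ball _ (by norm_num)]; exact hsub)).diffContOnCl) hbd
  rw [iteratedDeriv_succ, iteratedDeriv_one] at this
  simp only [deriv_sub_const_fun] at this
  refine this.trans (le_of_eq ?_)
  norm_num [Nat.factorial]
  ring

theorem exists_differentiableOn_re_eq_clm {E : Type*} [NormedAddCommGroup E] [NormedSpace ℝ E]
    {X : ℝ × ℝ → E} (hX : ContDiffOn ℝ 2 X unitB)
    (hΔ : ∀ p ∈ unitB, pd1 (pd1 X) p + pd2 (pd2 X) p = 0) (l : E →L[ℝ] ℝ) :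
    ∃ F : ℂ → ℂ, DifferentiableOn ℂ F (ball 0 1) ∧
      (∀ z ∈ ball (0 : ℂ) 1, (F z).re = l (X (z.re, z.im))) ∧
      (∀ z ∈ ball (0 : ℂ) 1, deriv F z = ⟨l (pd1 X (z.re, z.im)), -l (pd2 X (z.re, z.im))⟩) ∧
      deriv (deriv F) 0 = ⟨l (pd1 (pd1 X) (0, 0)), -l (pd1 (pd2 X) (0, 0))⟩ := by
  have hX1 : ContDiffOn ℝ 1 X unitB := hX.of_le (by norm_num)
  have h1 : ∀ p ∈ unitB, pd1 (fun q => l (X q)) p = l (pd1 X p) := fun p hp =>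
    fderiv_clm_comp_of_mem_unitB hX1 l hp _
  have h2 : ∀ p ∈ unitB, pd2 (fun q => l (X q)) p = l (pd2 X p) := fun p hp =>
    fderiv_clm_comp_of_mem_unitB hX1 l hp _
  have e1 : ∀ p ∈ unitB, pd1 (fun q => l (X q)) =ᶠ[𝓝 p] fun q => l (pd1 X q) := fun p hp => by
    filter_upwards [isOpen_unitB.mem_nhds hp] with q hq using h1 q hq
  have e2 : ∀ p ∈ unitB, pd2 (fun q => l (X q)) =ᶠ[𝓝 p] fun q => l (pd2 X q) := fun p hp => by
    filter_upwards [isOpen_unitB.mem_nhds hp] with q hq using h2 q hq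
  have h11 : ∀ p ∈ unitB, pd1 (pd1 (fun q => l (X q))) p = l (pd1 (pd1 X) p) := fun p hp => by
    rw [pd1, (e1 p hp).fderiv_eq]
    exact fderiv_clm_comp_of_mem_unitB (contDiffOn_pd1 hX) l hp _
  have h12 : ∀ p ∈ unitB, pd1 (pd2 (fun q => l (X q))) p = l (pd1 (pd2 X) p) := fun p hp => by
    rw [pd1, (e2 p hp).fderiv_eq]
    exact fderiv_clm_comp_of_mem_unitB (contDiffOn_pd2 hX) l hp _
  have h22 : ∀ p ∈ unitB, pd2 (pd2 (fun q => l (X q))) p = l (pd2 (pd2 X) p) := fun p hp => by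
    rw [pd2, (e2 p hp).fderiv_eq]
    exact fderiv_clm_comp_of_mem_unitB (contDiffOn_pd2 hX) l hp _
  obtain ⟨F, hF, hre, hd, hdd⟩ := exists_differentiableOn_re_eq (x := fun q => l (X q))
    (l.contDiff.comp_contDiffOn hX) fun p hp => by
      rw [h11 p hp, h22 p hp, ← map_add, hΔ p hp, map_zero]
  refine ⟨F, hF, hre, fun z hz => ?_, ?_⟩
  · rw [hd z hz, h1 _ (mem_unitB_iff.2 hz), h2 _ (mem_unitB_iff.2 hz)]
  · have h0 : ((0 : ℝ), (0 : ℝ)) ∈ unitB := by simp [unitB]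
    rw [hdd, h11 _ h0, h12 _ h0]

theorem mem_closure_unitB {z : ℂ} (hz : z ∈ closedBall (0 : ℂ) 1) :
    (z.re, z.im) ∈ closure unitB := by
  rw [← closure_ball _ one_ne_zero] at hz
  exact map_mem_closure (f := Complex.equivRealProdCLM) Complex.equivRealProdCLM.continuous hz
    fun w hw => equivRealProdCLM_mem_unitB_iff.2 hw

theorem continuousOn_closedBall_of_closure_unitB {E : Type*} [TopologicalSpace E]
    {X : ℝ × ℝ → E} (hX : ContinuousOn X (closure unitB)) :
    ContinuousOn (fun z : ℂ => X (z.re, z.im)) (closedBall 0 1) :=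
  hX.comp (by fun_prop) fun _ hz => mem_closure_unitB hz

theorem bddAbove_norm_unitB {E : Type*} [NormedAddCommGroup E] {X : ℝ × ℝ → E}
    (hX : ContinuousOn X (closure unitB)) :
    BddAbove (Set.range fun p : unitB => ‖X (p : ℝ × ℝ)‖) := by
  obtain ⟨C, hC⟩ := (isCompact_closedBall (0 : ℂ) 1).exists_bound_of_continuousOn
    (continuousOn_closedBall_of_closure_unitB hX)
  refine ⟨C, ?_⟩
  rintro _ ⟨⟨⟨a, b⟩, hp⟩, rfl⟩
  exact hC ⟨a, b⟩ (ball_subset_closedBall (mem_unitB_iff.1 hp))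

theorem sq_add_sq_le_norm_sq {n : ℕ} (v : EuclideanSpace ℝ (Fin n)) {i j : Fin n} (hij : i ≠ j) :
    v i ^ 2 + v j ^ 2 ≤ ‖v‖ ^ 2 := by
  rw [EuclideanSpace.real_norm_sq_eq, ← Finset.sum_pair (f := fun k => v k ^ 2) hij]
  exact Finset.sum_le_sum_of_subset_of_nonneg (Finset.subset_univ _) fun _ _ _ => sq_nonneg _

/-- A Heinz type lower bound for the area element at the centre of a graph over the disc of
radius `R`. -/
theorem area_element_ge {n : ℕ} {R : ℝ} (hR : 0 < R) {X : ℝ × ℝ → EuclideanSpace ℝ (Fin n)}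
    (hX : ContDiffOn ℝ 2 X unitB) (hXc : ContinuousOn X (closure unitB))
    (hΔ : ∀ p ∈ unitB, pd1 (pd1 X) p + pd2 (pd2 X) p = 0) {i j : Fin n} (hij : i ≠ j)
    (hJ : ∀ p ∈ unitB, 0 < pd1 (fun q => X q i) p * pd2 (fun q => X q j) p
      - pd1 (fun q => X q j) p * pd2 (fun q => X q i) p)
    (h0 : X (0, 0) i = 0 ∧ X (0, 0) j = 0)
    (hcirc : Set.MapsTo (fun p => (X p i, X p j)) (circleR 1) (circleR R)) :
    R ^ 2 / 8 ≤ ‖pd1 X (0, 0)‖ ^ 2 + ‖pd2 X (0, 0)‖ ^ 2 := by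
  have hX1 : ContDiffOn ℝ 1 X unitB := hX.of_le (by norm_num)
  have hpr : ∀ (k : Fin n), ∀ p ∈ unitB, ∀ v, fderiv ℝ (fun q => X q k) p v = fderiv ℝ X p v k :=
    fun k p hp v => fderiv_clm_comp_of_mem_unitB hX1 (EuclideanSpace.proj k) hp v
  obtain ⟨F, hF, hFre, hFd, -⟩ :=
    exists_differentiableOn_re_eq_clm hX hΔ (EuclideanSpace.proj (𝕜 := ℝ) i)
  obtain ⟨G, hG, hGre, hGd, -⟩ :=
    exists_differentiableOn_re_eq_clm hX hΔ (EuclideanSpace.proj (𝕜 := ℝ) j)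
  simp only [PiLp.proj_apply] at hFre hFd hGre hGd
  have hz0 : (0 : ℂ) ∈ ball (0 : ℂ) 1 := by simp
  have hJac : ∀ z ∈ ball (0 : ℂ) 1, ‖deriv F z‖ ^ 2 + ‖deriv G z‖ ^ 2 <
      ‖deriv F z + Complex.I * deriv G z‖ ^ 2 := by
    intro z hz
    have := hJ _ (mem_unitB_iff.2 hz)
    simp only [pd1, pd2, hpr _ _ (mem_unitB_iff.2 hz)] at this
    simp only [hFd z hz, hGd z hz, Complex.sq_norm, Complex.normSq_apply, pd1, pd2]
    simp
    nlinarith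
  set f : ℂ → ℝ := fun z => X (z.re, z.im) i ^ 2 + X (z.re, z.im) j ^ 2 with hf
  have hc := continuousOn_closedBall_of_closure_unitB hXc
  have hfc : ContinuousOn f (closedBall 0 1) :=
    (((EuclideanSpace.proj (𝕜 := ℝ) i).continuous.comp_continuousOn hc).pow 2).add
      (((EuclideanSpace.proj (𝕜 := ℝ) j).continuous.comp_continuousOn hc).pow 2)
  have hK : IsCompact (closedBall (0 : ℂ) 1 ∩ f ⁻¹' Set.Iic ((R / 2) ^ 2)) :=
    (isCompact_closedBall 0 1).of_isClosed_subset
      (hfc.preimage_isClosed_of_isClosed isClosed_closedBall isClosed_Iic) Set.inter_subset_left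
  have key := norm_deriv_ge_of_compact_preimage hF hG (r := R / 2) (by positivity) hK
    (by
      rintro z ⟨hz, hzf⟩
      rw [mem_closedBall_zero_iff] at hz
      rw [mem_ball_zero_iff]
      refine lt_of_le_of_ne hz fun h1 => ?_
      have hm : (z.re, z.im) ∈ circleR 1 := by
        have : ‖z‖ ^ 2 = 1 := by rw [h1]; norm_num
        rw [Complex.sq_norm, Complex.normSq_apply] at this
        simp only [circleR, Set.mem_ofPred_eq]
        linarith
      have hm' : f z = R ^ 2 := hcirc hm
      have hzf' : f z ≤ (R / 2) ^ 2 := hzf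
      nlinarith)
    (by
      intro z hz hle
      refine ⟨ball_subset_closedBall hz, ?_⟩
      rw [hFre z hz, hGre z hz] at hle
      exact hle)
    (by rw [hFre 0 hz0]; exact h0.1) (by rw [hGre 0 hz0]; exact h0.2)
    (fun z hz h => by
      have := hJac z hz
      rw [h, norm_zero] at this
      nlinarith [sq_nonneg ‖deriv F z‖, sq_nonneg ‖deriv G z‖])
    (fun z hz => (hJac z hz).le)
  have h1 := sq_add_sq_le_norm_sq (pd1 X (0, 0)) hij
  have h2 := sq_add_sq_le_norm_sq (pd2 X (0, 0)) hij
  simp only [hFd 0 hz0, hGd 0 hz0, Complex.sq_norm, Complex.normSq_apply] at key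
  simp at key
  nlinarith [sq_nonneg (pd1 X (0, 0) i - pd2 X (0, 0) j),
    sq_nonneg (pd2 X (0, 0) i + pd1 X (0, 0) j)]

end

/-- Curvature estimate for two-dimensional minimal surface graphs in ℝⁿ:
there is a universal constant `Θ` such that, for any conformally parametrized
minimal surface graph over `B_R`, the principal curvatures in the direction of
any differentiable unit normal field satisfy
`κ₁(0,0)² + κ₂(0,0)² ≤ Θ‖X‖²_{C⁰(B)}/R⁴`, where in conformal parameters
`κ₁² + κ₂² = (L₁₁² + 2L₁₂² + L₂₂²)/W²`. -/
theorem curvature_estimate_minimal_graph :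
    ∃ Θ : ℝ, 0 < Θ ∧
      ∀ (n : ℕ), 3 ≤ n →
      ∀ (R : ℝ), 0 < R →
      ∀ (X : ℝ × ℝ → EuclideanSpace ℝ (Fin n)) (W : ℝ × ℝ → ℝ),
        ContDiffOn ℝ 2 X unitB →
        ContinuousOn X (closure unitB) →
        -- `X` is harmonic (a conformally parametrized minimal surface)
        (∀ p ∈ unitB, pd1 (pd1 X) p + pd2 (pd2 X) p = 0) →
        -- conformality relations
        (∀ p ∈ unitB,
          ‖pd1 X p‖ ^ 2 = W p ∧ ‖pd2 X p‖ ^ 2 = W p ∧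
          ⟪pd1 X p, pd2 X p⟫ = 0 ∧ 0 < W p) →
        -- the plane mapping `F* = (x¹, x²)` maps `B̄` one-to-one onto `B̄_R` ...
        ∀ hn' : 3 ≤ n,
        (Set.BijOn (fun p => (X p ⟨0, by omega⟩, X p ⟨1, by omega⟩))
          (closure unitB) (closure (diskR R))) →
        -- ... with positive Jacobian in `B` ...
        (∀ p ∈ unitB,
          pd1 (fun q => X q (⟨0, by omega⟩ : Fin n)) p *
            pd2 (fun q => X q (⟨1, by omega⟩ : Fin n)) p -
          pd1 (fun q => X q (⟨1, by omega⟩ : Fin n)) p *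
            pd2 (fun q => X q (⟨0, by omega⟩ : Fin n)) p > 0) →
        -- ... it satisfies `F*(0,0) = (0,0)` ...
        (X (0, 0) (⟨0, by omega⟩ : Fin n) = 0 ∧
         X (0, 0) (⟨1, by omega⟩ : Fin n) = 0) →
        -- ... and maps `∂B` topologically onto `∂B_R`
        (Set.BijOn (fun p => (X p ⟨0, by omega⟩, X p ⟨1, by omega⟩))
          (circleR 1) (circleR R)) →
        -- then for every differentiable unit normal field `N` along `X` ...
        ∀ N : ℝ × ℝ → EuclideanSpace ℝ (Fin n),
          DifferentiableOn ℝ N unitB →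
          (∀ p ∈ unitB, ‖N p‖ = 1 ∧ ⟪N p, pd1 X p⟫ = 0 ∧ ⟪N p, pd2 X p⟫ = 0) →
          -- ... the principal curvature estimate holds at the origin:
          (⟪pd1 (pd1 X) (0, 0), N (0, 0)⟫ ^ 2 +
            2 * ⟪pd1 (pd2 X) (0, 0), N (0, 0)⟫ ^ 2 +
            ⟪pd2 (pd2 X) (0, 0), N (0, 0)⟫ ^ 2) / (W (0, 0)) ^ 2
            ≤ Θ * (⨆ p : unitB, ‖X (p : ℝ × ℝ)‖) ^ 2 / R ^ 4 := by
  refine ⟨524288, by norm_num, ?_⟩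
  intro n _ R hR X W hX hXc hΔ hconf hn' _ hJ h0 hcirc N _ hN
  have hm0 : ((0 : ℝ), (0 : ℝ)) ∈ unitB := by simp [unitB]
  obtain ⟨hW1, hW2, -, hW⟩ := hconf _ hm0
  have hWR : R ^ 2 / 16 ≤ W (0, 0) := by
    have := area_element_ge hR hX hXc hΔ (i := ⟨0, by omega⟩) (j := ⟨1, by omega⟩) (by simp)
      hJ h0 hcirc.mapsTo
    linarith
  set M := ⨆ p : unitB, ‖X (p : ℝ × ℝ)‖
  have hXM : ∀ p ∈ unitB, ‖X p‖ ≤ M := fun p hp => le_ciSup (bddAbove_norm_unitB hXc) ⟨p, hp⟩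
  have hM0 : 0 ≤ M := (norm_nonneg _).trans (hXM _ hm0)
  obtain ⟨F, hF, hre, -, hdd⟩ := exists_differentiableOn_re_eq_clm hX hΔ (innerSL ℝ (N (0, 0)))
  have hbound := norm_deriv_deriv_le_of_abs_re_le hF (M := M) fun z hz => by
    rw [hre z hz, innerSL_apply_apply]
    refine (abs_real_inner_le_norm _ _).trans ?_
    rw [(hN _ hm0).1, one_mul]
    exact hXM _ (mem_unitB_iff.2 hz)
  have hsq : ‖deriv (deriv F) 0‖ ^ 2 ≤ (32 * M) ^ 2 := by gcongr
  rw [hdd, Complex.sq_norm, Complex.normSq_apply] at hsq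
  simp only [innerSL_apply_apply, real_inner_comm _ (N (0, 0))] at hsq
  have h22 : pd2 (pd2 X) (0, 0) = -pd1 (pd1 X) (0, 0) :=
    eq_neg_of_add_eq_zero_right (hΔ _ hm0)
  rw [h22, inner_neg_left, div_le_div_iff₀ (by positivity) (by positivity)]
  have hW' : R ^ 4 / 256 ≤ W (0, 0) ^ 2 := by
    have := pow_le_pow_left₀ (by positivity) hWR 2
    linarith
  calc _ ≤ 2048 * M ^ 2 * R ^ 4 := by gcongr; linarith
    _ ≤ 524288 * M ^ 2 * W (0, 0) ^ 2 := by
      have := mul_le_mul_of_nonneg_left hW' (by positivity : 0 ≤ 524288 * M ^ 2)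
      linarith
end

section
/- Let n ≥ 3 and let ψ = (φ₁,…,φ_{n−2}) ∈ C²(ℝ²,ℝ^{n−2}) be an entire solution of the minimal surface system: h₂₂·ψ_{xx} − 2h₁₂·ψ_{xy} + h₁₁·ψ_{yy} = 0 in ℝ², where h₁₁ := 1+|ψ_x|², h₁₂ := ψ_x·ψ_y, h₂₂ := 1+|ψ_y|². Suppose there are constants Ω ∈ (0,∞), ω ∈ [0,2) and R₀ > 0 such that for all R ≥ R₀, sup_{(x,y)∈B_R} |(x, y, ψ(x,y))| ≤ Ω·R^ω. Then the graph X(x,y) = (x,y,ψ(x,y)) represents an affine plane, i.e. each component function φ_Σ (Σ = 1,…,n−2) is an affine function of (x,y). -/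
open scoped RealInnerProductSpace

open Filter Topology Metric in
/-- An entire function whose real part grows subquadratically has vanishing second derivative. -/
theorem iteratedDeriv_two_eq_zero_of_re_le {f : ℂ → ℂ} (hf : Differentiable ℂ f)
    {K ω R₀ : ℝ} (hK : 0 < K) (hω : ω < 2) (hR₀ : 0 < R₀)
    (hre : ∀ R, R₀ ≤ R → ∀ z : ℂ, ‖z‖ < R → (f z).re ≤ K * R ^ ω) (c : ℂ) :
    iteratedDeriv 2 f c = 0 := by
  have hnorm : ∀ R, R₀ ≤ R → ∀ z : ℂ, ‖z‖ ≤ R → ‖f z‖ ≤ 2 * K * (2 * R) ^ ω + 3 * ‖f 0‖ := by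
    intro R hR z hz
    have hRpos : 0 < R := hR₀.trans_le hR
    have hM : 0 < K * (2 * R) ^ ω := by positivity
    have h := Complex.borelCaratheodory (R := 2 * R) (z := z) hM hf.differentiableOn
      (fun x hx ↦ hre _ (by linarith) x (by simpa using hx)) (by linarith)
      (by simpa using by linarith)
    have hd : 0 < 2 * R - ‖z‖ := by linarith
    have h₁ : 2 * (K * (2 * R) ^ ω) * ‖z‖ / (2 * R - ‖z‖) ≤ 2 * K * (2 * R) ^ ω := by
      rw [div_le_iff₀ hd]
      nlinarith
    have h₂ : ‖f 0‖ * (2 * R + ‖z‖) / (2 * R - ‖z‖) ≤ 3 * ‖f 0‖ := by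
      rw [div_le_iff₀ hd]
      nlinarith [norm_nonneg (f 0)]
    linarith
  have hbound : ∀ᶠ R : ℝ in atTop, ‖iteratedDeriv 2 f c‖ ≤
      4 * K * 4 ^ ω * R ^ (-(2 - ω)) + 6 * ‖f 0‖ * R ^ (-(2 : ℝ)) := by
    filter_upwards [eventually_ge_atTop R₀, eventually_ge_atTop ‖c‖] with R hR hc
    have hRpos : 0 < R := hR₀.trans_le hR
    have h := Complex.norm_iteratedDeriv_le_of_forall_mem_sphere_norm_le 2 hRpos
      (hf.diffContOnCl (s := ball c R)) (C := 2 * K * (4 * R) ^ ω + 3 * ‖f 0‖) (fun z hz ↦ by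
        have hz' : ‖z‖ ≤ 2 * R := by
          have := norm_le_norm_sub_add z c
          rw [mem_sphere_iff_norm.1 hz] at this
          linarith
        have := hnorm (2 * R) (by linarith) z hz'
        rwa [← mul_assoc, show (2 : ℝ) * 2 = 4 by norm_num] at this)
    refine h.trans_eq ?_
    rw [Real.mul_rpow (by norm_num) hRpos.le, show -(2 - ω) = ω - (2 : ℕ) by push_cast; ring,
      Real.rpow_sub_natCast hRpos.ne', Real.rpow_neg hRpos.le, Real.rpow_ofNat]
    simp only [Nat.factorial]
    push_cast
    field_simp
    ring
  have hlim : Tendsto (fun R : ℝ ↦ 4 * K * 4 ^ ω * R ^ (-(2 - ω)) + 6 * ‖f 0‖ * R ^ (-(2 : ℝ)))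
      atTop (𝓝 0) := by
    simpa using ((tendsto_rpow_neg_atTop (sub_pos.2 hω)).const_mul (4 * K * 4 ^ ω)).add
      ((tendsto_rpow_neg_atTop (two_pos (α := ℝ))).const_mul (6 * ‖f 0‖))
  exact norm_le_zero_iff.1 (ge_of_tendsto hlim hbound)

/-- **Liouville's theorem** for harmonic functions of subquadratic growth on the plane. -/
theorem InnerProductSpace.HarmonicOnNhd.exists_eq_affine_of_le {u : ℂ → ℝ}
    (hu : InnerProductSpace.HarmonicOnNhd u Set.univ) {K ω R₀ : ℝ} (hK : 0 < K) (hω : ω < 2)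
    (hR₀ : 0 < R₀) (hle : ∀ R, R₀ ≤ R → ∀ z : ℂ, ‖z‖ < R → u z ≤ K * R ^ ω) :
    ∃ a b c : ℝ, ∀ z : ℂ, u z = z.re * a + z.im * b + c := by
  obtain ⟨f, hfan, rfl⟩ := hu.exists_analyticOnNhd_univ_re_eq
  have hf : Differentiable ℂ f := fun z ↦ (hfan z trivial).differentiableAt
  have hderiv : ∀ z, deriv f z = deriv f 0 := fun z ↦
    is_const_of_deriv_eq_zero hf.deriv (fun w ↦ by
      simpa [iteratedDeriv_succ, iteratedDeriv_zero] using
        iteratedDeriv_two_eq_zero_of_re_le hf hK hω hR₀ hle w) z 0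
  have hlin : ∀ z, f z = deriv f 0 * z + f 0 := fun z ↦ by
    have hd : ∀ w, HasDerivAt (fun w ↦ f w - deriv f 0 * w) (deriv f w - deriv f 0 * 1) w :=
      fun w ↦ (hf w).hasDerivAt.sub ((hasDerivAt_id w).const_mul _)
    have := is_const_of_deriv_eq_zero (fun w ↦ (hd w).differentiableAt)
      (fun w ↦ by rw [(hd w).deriv, hderiv w]; ring) z 0
    linear_combination this
  refine ⟨(deriv f 0).re, -(deriv f 0).im, (f 0).re, fun z ↦ ?_⟩
  change (f z).re = _
  rw [hlin z]
  simp only [Complex.add_re, Complex.mul_re]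
  ring

theorem fderiv_apply_eq_pd {E : Type*} [NormedAddCommGroup E] [NormedSpace ℝ E]
    (f : ℝ × ℝ → E) (p v : ℝ × ℝ) : fderiv ℝ f p v = v.1 • pd1 f p + v.2 • pd2 f p := by
  rw [pd1, pd2, ← map_smul, ← map_smul, ← map_add]
  simp

open ContinuousLinearMap in
/-- The Poincaré lemma for `a dx + b dy` on the plane. -/
theorem exists_potential {a b : ℝ × ℝ → ℝ} (ha : Differentiable ℝ a) (hb : Differentiable ℝ b)
    (hab : ∀ p, pd2 a p = pd1 b p) :
    ∃ F : ℝ × ℝ → ℝ, ∀ p, HasFDerivAt F (a p • fst ℝ ℝ ℝ + b p • snd ℝ ℝ ℝ) p := by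
  have hd : ∀ p, HasFDerivAt (fun p ↦ a p • fst ℝ ℝ ℝ + b p • snd ℝ ℝ ℝ)
      ((fderiv ℝ a p).smulRight (fst ℝ ℝ ℝ) + (fderiv ℝ b p).smulRight (snd ℝ ℝ ℝ)) p := fun p ↦
    ((ha p).hasFDerivAt.smul_const (fst ℝ ℝ ℝ)).add
      ((hb p).hasFDerivAt.smul_const (snd ℝ ℝ ℝ))
  obtain ⟨F, hF⟩ := convex_univ.exists_forall_hasFDerivAt_of_fderiv_symmetric isOpen_univ
    (ω := fun p ↦ a p • fst ℝ ℝ ℝ + b p • snd ℝ ℝ ℝ)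
    (fun p _ ↦ (hd p).differentiableAt.differentiableWithinAt) (fun p _ v w ↦ by
      rw [(hd p).fderiv]
      simp only [add_apply, smulRight_apply, fderiv_apply_eq_pd, smul_apply, coe_fst', coe_snd',
        smul_eq_mul]
      linear_combination (v.2 * w.1 - v.1 * w.2) * hab p)
  exact ⟨F, fun p ↦ hF p trivial⟩

section UnimodularGradient

open ContinuousLinearMap Complex Asymptotics

variable {A B C F G : ℝ × ℝ → ℝ}

/-- A planar map with positive semidefinite symmetric derivative is monotone. -/
theorem monotone_inner_of_hasFDerivAt
    (hF : ∀ p, HasFDerivAt F (A p • fst ℝ ℝ ℝ + B p • snd ℝ ℝ ℝ) p)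
    (hG : ∀ p, HasFDerivAt G (B p • fst ℝ ℝ ℝ + C p • snd ℝ ℝ ℝ) p)
    (hpos : ∀ p, 0 < A p) (hdet : ∀ p, A p * C p - B p ^ 2 = 1) (p q : ℝ × ℝ) :
    0 ≤ (q.1 - p.1) * (F q - F p) + (q.2 - p.2) * (G q - G p) := by
  have hline : ∀ t : ℝ, HasDerivAt (fun t : ℝ ↦ p + t • (q - p)) (q - p) t := fun t ↦ by
    simpa using ((hasDerivAt_id t).smul_const (q - p)).const_add p
  have hd : ∀ t : ℝ, HasDerivAt
      (fun t : ℝ ↦ (q.1 - p.1) * F (p + t • (q - p)) + (q.2 - p.2) * G (p + t • (q - p)))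
      (A (p + t • (q - p)) * (q.1 - p.1) ^ 2
        + 2 * B (p + t • (q - p)) * ((q.1 - p.1) * (q.2 - p.2))
        + C (p + t • (q - p)) * (q.2 - p.2) ^ 2) t := fun t ↦ by
    refine ((((hF _).comp_hasDerivAt t (hline t)).const_mul (q.1 - p.1)).add
      (((hG _).comp_hasDerivAt t (hline t)).const_mul (q.2 - p.2))).congr_deriv ?_
    simp only [add_apply, smul_apply, coe_fst', coe_snd', smul_eq_mul, Prod.fst_sub, Prod.snd_sub]
    ring
  have hmono := monotone_of_hasDerivAt_nonneg hd (fun t ↦ by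
    set r := p + t • (q - p)
    refine nonneg_of_mul_nonneg_right (a := A r) ?_ (hpos r)
    have : A r * (A r * (q.1 - p.1) ^ 2 + 2 * B r * ((q.1 - p.1) * (q.2 - p.2))
        + C r * (q.2 - p.2) ^ 2)
        = (A r * (q.1 - p.1) + B r * (q.2 - p.2)) ^ 2 + (q.2 - p.2) ^ 2 := by
      linear_combination (q.2 - p.2) ^ 2 * hdet r
    rw [this]
    positivity)
  have h := hmono zero_le_one
  simp only [zero_smul, add_zero, one_smul, add_sub_cancel] at h
  linarith

/-- The Lewy transform `p ↦ p + (F p, G p)` as a map into `ℂ`. -/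
def lewyMap (F G : ℝ × ℝ → ℝ) (p : ℝ × ℝ) : ℂ := ⟨p.1 + F p, p.2 + G p⟩

/-- The conjugate of `p ↦ p - (F p, G p)` as a map into `ℂ`. -/
def lewyConj (F G : ℝ × ℝ → ℝ) (p : ℝ × ℝ) : ℂ := ⟨p.1 - F p, G p - p.2⟩

/-- The real linear map `ℝ² → ℂ` with real and imaginary parts `l` and `m`. -/
noncomputable def complexOfPair (l m : ℝ × ℝ →L[ℝ] ℝ) : ℝ × ℝ →L[ℝ] ℂ :=
  equivRealProdCLM.symm.toContinuousLinearMap ∘L l.prod m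

theorem complexOfPair_apply (l m : ℝ × ℝ →L[ℝ] ℝ) (v : ℝ × ℝ) :
    complexOfPair l m v = ⟨l v, m v⟩ := rfl

theorem HasStrictFDerivAt.complexOfPair {f g : ℝ × ℝ → ℝ} {l m : ℝ × ℝ →L[ℝ] ℝ} {p : ℝ × ℝ}
    (hf : HasStrictFDerivAt f l p) (hg : HasStrictFDerivAt g m p) :
    HasStrictFDerivAt (fun q ↦ (⟨f q, g q⟩ : ℂ)) (complexOfPair l m) p :=
  equivRealProdCLM.symm.toContinuousLinearMap.hasStrictFDerivAt.comp p (hf.prodMk hg)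

theorem hasStrictFDerivAt_lewyMap {l m : ℝ × ℝ →L[ℝ] ℝ} {p : ℝ × ℝ}
    (hF : HasStrictFDerivAt F l p) (hG : HasStrictFDerivAt G m p) :
    HasStrictFDerivAt (lewyMap F G) (complexOfPair (fst ℝ ℝ ℝ + l) (snd ℝ ℝ ℝ + m)) p :=
  (hasStrictFDerivAt_fst.add hF).complexOfPair (hasStrictFDerivAt_snd.add hG)

theorem hasStrictFDerivAt_lewyConj {l m : ℝ × ℝ →L[ℝ] ℝ} {p : ℝ × ℝ}
    (hF : HasStrictFDerivAt F l p) (hG : HasStrictFDerivAt G m p) :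
    HasStrictFDerivAt (lewyConj F G) (complexOfPair (fst ℝ ℝ ℝ - l) (m - snd ℝ ℝ ℝ)) p :=
  (hasStrictFDerivAt_fst.sub hF).complexOfPair (hG.sub hasStrictFDerivAt_snd)

theorem hasStrictFDerivAt_of_continuous_partials (hA : Continuous A) (hB : Continuous B)
    (hF : ∀ p, HasFDerivAt F (A p • fst ℝ ℝ ℝ + B p • snd ℝ ℝ ℝ) p) (p : ℝ × ℝ) :
    HasStrictFDerivAt F (A p • fst ℝ ℝ ℝ + B p • snd ℝ ℝ ℝ) p :=
  hasStrictFDerivAt_of_hasFDerivAt_of_continuousAt (f' := fun p ↦ A p • fst ℝ ℝ ℝ + B p • snd ℝ ℝ ℝ)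
    (Filter.Eventually.of_forall hF) (by fun_prop)

theorem antilipschitzWith_lewyMap
    (hmono : ∀ p q : ℝ × ℝ, 0 ≤ (q.1 - p.1) * (F q - F p) + (q.2 - p.2) * (G q - G p)) :
    AntilipschitzWith 1 (lewyMap F G) := by
  refine AntilipschitzWith.of_le_mul_dist fun p q ↦ ?_
  rw [NNReal.coe_one, one_mul, dist_eq_norm, dist_eq_norm, ← sq_le_sq₀ (norm_nonneg _)
    (norm_nonneg _), Complex.sq_norm, normSq_apply]
  simp only [lewyMap, sub_re, sub_im]
  have h := hmono q p
  rcases max_cases ‖(p - q).1‖ ‖(p - q).2‖ with ⟨h', -⟩ | ⟨h', -⟩ <;>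
  · rw [Prod.norm_def, h', Real.norm_eq_abs, sq_abs]
    simp only [Prod.fst_sub, Prod.snd_sub]
    nlinarith [sq_nonneg (F p - F q), sq_nonneg (G p - G q), sq_nonneg (p.1 - q.1),
      sq_nonneg (p.2 - q.2)]

theorem surjective_lewyMap
    (hF : ∀ p, HasStrictFDerivAt F (A p • fst ℝ ℝ ℝ + B p • snd ℝ ℝ ℝ) p)
    (hG : ∀ p, HasStrictFDerivAt G (B p • fst ℝ ℝ ℝ + C p • snd ℝ ℝ ℝ) p)
    (hpos : ∀ p, 0 < A p) (hdet : ∀ p, A p * C p - B p ^ 2 = 1) :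
    Function.Surjective (lewyMap F G) := by
  have hd := fun p ↦ hasStrictFDerivAt_lewyMap (hF p) (hG p)
  have hcont : Continuous (lewyMap F G) :=
    continuous_iff_continuousAt.2 fun p ↦ (hd p).hasFDerivAt.continuousAt
  have hanti := antilipschitzWith_lewyMap (monotone_inner_of_hasFDerivAt
    (fun p ↦ (hF p).hasFDerivAt) (fun p ↦ (hG p).hasFDerivAt) hpos hdet)
  have hproper : IsProperMap (lewyMap F G) := isProperMap_iff_tendsto_cocompact.2
    ⟨hcont, by simpa only [Metric.cobounded_eq_cocompact] using hanti.tendsto_cobounded⟩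
  have hopen : IsOpenMap (lewyMap F G) := IsOpenMap.of_nhds_le fun p ↦ by
    refine ((hd p).map_nhds_eq_of_surj ?_).ge
    rw [LinearMap.range_eq_top]
    intro w
    have hdet' := hdet p
    have hD : 2 + A p + C p ≠ 0 := by nlinarith [hpos p, sq_nonneg (B p)]
    refine ⟨(((1 + C p) * w.re - B p * w.im) / (2 + A p + C p),
      ((1 + A p) * w.im - B p * w.re) / (2 + A p + C p)), ?_⟩
    apply Complex.ext <;>
      simp only [coe_coe, complexOfPair_apply, add_apply, smul_apply, coe_fst', coe_snd',
        smul_eq_mul] <;> field_simp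
    · linear_combination w.re * hdet'
    · linear_combination w.im * hdet'
  exact Set.range_eq_univ.1 <| IsClopen.eq_univ
    ⟨hproper.isClosedMap.isClosed_range, hopen.isOpen_range⟩ (Set.range_nonempty _)

/-- A positive symmetric `2 × 2` matrix field of determinant one whose rows are gradients on the
whole plane is constant (**Jörgens' theorem**). -/
theorem eq_of_gradient_rows_of_det_eq_one (hA : Continuous A) (hB : Continuous B)
    (hC : Continuous C)
    (hF : ∀ p, HasFDerivAt F (A p • fst ℝ ℝ ℝ + B p • snd ℝ ℝ ℝ) p)
    (hG : ∀ p, HasFDerivAt G (B p • fst ℝ ℝ ℝ + C p • snd ℝ ℝ ℝ) p)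
    (hpos : ∀ p, 0 < A p) (hdet : ∀ p, A p * C p - B p ^ 2 = 1) (p q : ℝ × ℝ) :
    A p = A q ∧ B p = B q ∧ C p = C q := by
  have hF' := hasStrictFDerivAt_of_continuous_partials hA hB hF
  have hG' := hasStrictFDerivAt_of_continuous_partials hB hC hG
  have hD : ∀ p, 0 < 2 + A p + C p := fun p ↦ by nlinarith [hpos p, hdet p, sq_nonneg (B p)]
  have hanti := antilipschitzWith_lewyMap (monotone_inner_of_hasFDerivAt hF hG hpos hdet)
  have hsurj := surjective_lewyMap hF' hG' hpos hdet
  let e := Equiv.ofBijective (lewyMap F G) ⟨hanti.injective, hsurj⟩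
  have hlip : LipschitzWith 1 e.symm := hanti.to_rightInverse e.right_inv
  let c : ℝ × ℝ → ℂ := fun p ↦
    ⟨(C p - A p) / (2 + A p + C p), 2 * B p / (2 + A p + C p)⟩
  have hnormSq : ∀ p, normSq (c p) = (A p + C p - 2) / (2 + A p + C p) := fun p ↦ by
    have := (hD p).ne'
    rw [normSq_apply]
    simp only [c]
    field_simp
    linear_combination (-4) * hdet p
  have hderiv : ∀ p, HasDerivAt (lewyConj F G ∘ e.symm) (c p) (lewyMap F G p) := fun p ↦ by
    have hzero : HasFDerivAt (fun r ↦ lewyConj F G r - c p * lewyMap F G r)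
        (0 : ℝ × ℝ →L[ℝ] ℂ) p := by
      refine ((hasStrictFDerivAt_lewyConj (hF' p) (hG' p)).hasFDerivAt.sub
        ((hasStrictFDerivAt_lewyMap (hF' p) (hG' p)).hasFDerivAt.const_mul (c p))).congr_fderiv ?_
      have := (hD p).ne'
      refine ContinuousLinearMap.ext fun v ↦ Complex.ext ?_ ?_ <;>
        simp only [c, sub_apply, smul_apply, complexOfPair_apply, add_apply, coe_fst', coe_snd',
          smul_eq_mul, sub_re, sub_im, mul_re, mul_im, zero_apply, zero_re, zero_im] <;> field_simp
      · linear_combination (-2 * v.1) * hdet p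
      · linear_combination (2 * v.2) * hdet p
    rw [hasDerivAt_iff_isLittleO]
    have hep : e.symm (lewyMap F G p) = p := e.symm_apply_apply p
    have he : ∀ z, lewyMap F G (e.symm z) = z := e.apply_symm_apply
    have ho := hzero.isLittleO.comp_tendsto (k := e.symm) (l' := nhds (lewyMap F G p)) (by
      simpa only [hep] using hlip.continuous.tendsto (lewyMap F G p))
    have hbig : (fun z ↦ e.symm z - p) =O[nhds (lewyMap F G p)] fun z ↦ z - lewyMap F G p :=
      .of_bound 1 <| .of_forall fun z ↦ by
        simpa [hep, dist_eq_norm] using hlip.dist_le_mul z (lewyMap F G p)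
    refine (ho.trans_isBigO hbig).congr_left fun z ↦ ?_
    simp only [Function.comp_apply, he, hep, zero_apply, smul_eq_mul]
    ring
  have hdiff : Differentiable ℂ (lewyConj F G ∘ e.symm) := fun z ↦ by
    obtain ⟨p, rfl⟩ := hsurj z
    exact (hderiv p).differentiableAt
  have hconst : c p = c q := by
    rw [← (hderiv p).deriv, ← (hderiv q).deriv]
    refine hdiff.deriv.apply_eq_apply_of_bounded ?_ _ _
    refine isBounded_iff_forall_norm_le.2 ⟨1, ?_⟩
    rintro _ ⟨z, rfl⟩
    obtain ⟨r, rfl⟩ := hsurj z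
    rw [(hderiv r).deriv, ← sq_le_one_iff₀ (norm_nonneg _), Complex.sq_norm, hnormSq,
      div_le_one (hD r)]
    linarith
  have htr : A p + C p = A q + C q := by
    have h := hnormSq p
    rw [hconst, hnormSq q, div_eq_div_iff (hD q).ne' (hD p).ne'] at h
    linarith
  have hre : C p - A p = C q - A q := by
    have h := congrArg Complex.re hconst
    simp only [c] at h
    rwa [add_assoc, add_assoc, htr, div_left_inj' (by have := hD q; linarith)] at h
  have him : 2 * B p = 2 * B q := by
    have h := congrArg Complex.im hconst
    simp only [c] at h
    rwa [add_assoc, add_assoc, htr, div_left_inj' (by have := hD q; linarith)] at h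
  exact ⟨by linarith, by linarith, by linarith⟩

end UnimodularGradient

theorem fderiv_div_sqrt_apply {a g : ℝ × ℝ → ℝ} {p : ℝ × ℝ} (ha : DifferentiableAt ℝ a p)
    (hg : DifferentiableAt ℝ g p) (hpos : 0 < g p) (v : ℝ × ℝ) :
    fderiv ℝ (fun r ↦ a r / √(g r)) p v
      = (fderiv ℝ a p v * g p - a p * (fderiv ℝ g p v / 2)) / (g p * √(g p)) := by
  have hs : √(g p) ≠ 0 := (Real.sqrt_pos.2 hpos).ne'
  have hinv := ((Real.hasDerivAt_sqrt hpos.ne').fun_inv hs).comp_hasFDerivAt p hg.hasFDerivAt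
  have h := ha.hasFDerivAt.fun_mul hinv
  simp only [Function.comp_apply, ← div_eq_mul_inv] at h
  have hsq := Real.sq_sqrt hpos.le
  set s := √(g p)
  rw [h.fderiv]
  simp only [add_apply, smul_apply, smul_eq_mul]
  rw [← hsq]
  field_simp
  ring

section FirstFundamentalForm

variable {V : Type*} [NormedAddCommGroup V] [InnerProductSpace ℝ V] {P Q : ℝ × ℝ → V}

/-- The determinant of the first fundamental form of a graph with tangent data `P`, `Q`. -/
noncomputable def metricDet (P Q : ℝ × ℝ → V) (p : ℝ × ℝ) : ℝ :=
  (1 + ⟪P p, P p⟫) * (1 + ⟪Q p, Q p⟫) - ⟪P p, Q p⟫ ^ 2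

theorem metricDet_pos (P Q : ℝ × ℝ → V) (p : ℝ × ℝ) : 0 < metricDet P Q p := by
  have h := real_inner_mul_inner_self_le (P p) (Q p)
  have hP : 0 ≤ ⟪P p, P p⟫ := real_inner_self_nonneg
  have hQ : 0 ≤ ⟪Q p, Q p⟫ := real_inner_self_nonneg
  rw [metricDet]
  nlinarith

theorem differentiable_metricDet (hP : Differentiable ℝ P) (hQ : Differentiable ℝ Q) :
    Differentiable ℝ (metricDet P Q) := by
  have h₁₁ := hP.inner ℝ hP
  have h₁₂ := hP.inner ℝ hQ
  have h₂₂ := hQ.inner ℝ hQ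
  unfold metricDet
  fun_prop

theorem fderiv_metricDet_apply (hP : Differentiable ℝ P) (hQ : Differentiable ℝ Q)
    (p v : ℝ × ℝ) :
    fderiv ℝ (metricDet P Q) p v = 2 * ⟪P p, fderiv ℝ P p v⟫ * (1 + ⟪Q p, Q p⟫)
      + (1 + ⟪P p, P p⟫) * (2 * ⟪Q p, fderiv ℝ Q p v⟫)
      - 2 * ⟪P p, Q p⟫ * (⟪P p, fderiv ℝ Q p v⟫ + ⟪Q p, fderiv ℝ P p v⟫) := by
  have h₁₁ := (hP p).hasFDerivAt.inner ℝ (hP p).hasFDerivAt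
  have h₁₂ := (hP p).hasFDerivAt.inner ℝ (hQ p).hasFDerivAt
  have h₂₂ := (hQ p).hasFDerivAt.inner ℝ (hQ p).hasFDerivAt
  have h : HasFDerivAt (metricDet P Q) _ p :=
    ((h₁₁.const_add 1).mul (h₂₂.const_add 1)).sub (h₁₂.pow 2)
  rw [h.fderiv]
  simp only [add_apply, sub_apply,
    smul_apply, ContinuousLinearMap.comp_apply, ContinuousLinearMap.prod_apply,
    fderivInnerCLM_apply, smul_eq_mul, real_inner_comm _ (fderiv ℝ P p v),
    real_inner_comm _ (fderiv ℝ Q p v)]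
  ring

/-- The minimal surface system in divergence form, first row. -/
theorem pd2_div_sqrt_eq_pd1_div_sqrt (hP : Differentiable ℝ P) (hQ : Differentiable ℝ Q)
    (p : ℝ × ℝ) (hsymm : pd1 Q p = pd2 P p)
    (hmin : (1 + ⟪Q p, Q p⟫) • pd1 P p - (2 * ⟪P p, Q p⟫) • pd1 Q p
      + (1 + ⟪P p, P p⟫) • pd2 Q p = 0) :
    pd2 (fun r ↦ (1 + ⟪P r, P r⟫) / √(metricDet P Q r)) p
      = pd1 (fun r ↦ ⟪P r, Q r⟫ / √(metricDet P Q r)) p := by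
  have h₁₁ := hP.inner ℝ hP
  have h₁₂ := hP.inner ℝ hQ
  have hdet := differentiable_metricDet hP hQ
  have hPmin := congrArg (inner ℝ (P p)) hmin
  have hQmin := congrArg (inner ℝ (Q p)) hmin
  simp only [inner_add_right, inner_sub_right, inner_smul_right, inner_zero_right, hsymm]
    at hPmin hQmin
  rw [pd2, pd1, fderiv_div_sqrt_apply ((h₁₁ p).const_add 1) (hdet p) (metricDet_pos P Q p),
    fderiv_div_sqrt_apply (h₁₂ p) (hdet p) (metricDet_pos P Q p)]
  congr 1
  rw [fderiv_metricDet_apply hP hQ, fderiv_metricDet_apply hP hQ, fderiv_const_add,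
    fderiv_inner_apply ℝ (hP p) (hP p), fderiv_inner_apply ℝ (hP p) (hQ p), metricDet]
  simp only [← pd1.eq_1, ← pd2.eq_1, hsymm, real_inner_comm (P p) (pd2 P p),
    real_inner_comm (Q p) (pd1 P p)]
  linear_combination ⟪P p, Q p⟫ * hPmin - (1 + ⟪P p, P p⟫) * hQmin

/-- The minimal surface system in divergence form, second row. -/
theorem pd2_div_sqrt_eq_pd1_div_sqrt' (hP : Differentiable ℝ P) (hQ : Differentiable ℝ Q)
    (p : ℝ × ℝ) (hsymm : pd1 Q p = pd2 P p)
    (hmin : (1 + ⟪Q p, Q p⟫) • pd1 P p - (2 * ⟪P p, Q p⟫) • pd1 Q p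
      + (1 + ⟪P p, P p⟫) • pd2 Q p = 0) :
    pd2 (fun r ↦ ⟪P r, Q r⟫ / √(metricDet P Q r)) p
      = pd1 (fun r ↦ (1 + ⟪Q r, Q r⟫) / √(metricDet P Q r)) p := by
  have h₁₂ := hP.inner ℝ hQ
  have h₂₂ := hQ.inner ℝ hQ
  have hdet := differentiable_metricDet hP hQ
  have hPmin := congrArg (inner ℝ (P p)) hmin
  have hQmin := congrArg (inner ℝ (Q p)) hmin
  simp only [inner_add_right, inner_sub_right, inner_smul_right, inner_zero_right, hsymm]
    at hPmin hQmin
  rw [pd2, pd1, fderiv_div_sqrt_apply (h₁₂ p) (hdet p) (metricDet_pos P Q p),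
    fderiv_div_sqrt_apply ((h₂₂ p).const_add 1) (hdet p) (metricDet_pos P Q p)]
  congr 1
  rw [fderiv_metricDet_apply hP hQ, fderiv_metricDet_apply hP hQ, fderiv_const_add,
    fderiv_inner_apply ℝ (hQ p) (hQ p), fderiv_inner_apply ℝ (hP p) (hQ p), metricDet]
  simp only [← pd1.eq_1, ← pd2.eq_1, hsymm, real_inner_comm (Q p) (pd2 P p)]
  linear_combination (1 + ⟪Q p, Q p⟫) * hPmin - ⟪P p, Q p⟫ * hQmin

end FirstFundamentalForm

section ConstantCoefficients

variable {V : Type*} [NormedAddCommGroup V] [NormedSpace ℝ V] {ψ : ℝ × ℝ → V}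

theorem fderiv_fderiv_apply (hψ : ContDiff ℝ 2 ψ) (p v w : ℝ × ℝ) :
    fderiv ℝ (fderiv ℝ ψ) p v w = (v.1 * w.1) • pd1 (pd1 ψ) p
      + (v.1 * w.2 + v.2 * w.1) • pd1 (pd2 ψ) p + (v.2 * w.2) • pd2 (pd2 ψ) p := by
  have hd : Differentiable ℝ (fderiv ℝ ψ) :=
    (hψ.fderiv_right (m := 1) (by norm_num)).differentiable one_ne_zero
  have happ : ∀ u u' : ℝ × ℝ,
      fderiv ℝ (fun q ↦ fderiv ℝ ψ q u') p u = fderiv ℝ (fderiv ℝ ψ) p u u' := fun u u' ↦ by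
    rw [fderiv_clm_apply (hd p) (differentiableAt_const _)]
    simp
  have hsymm := hψ.contDiffAt.isSymmSndFDerivAt (x := p) (by simp) (1, 0) (0, 1)
  have hv : ∀ u : ℝ × ℝ, u = u.1 • (1, 0) + u.2 • (0, 1) := fun u ↦ by simp
  have h₁₁ : pd1 (pd1 ψ) p = fderiv ℝ (fderiv ℝ ψ) p (1, 0) (1, 0) := happ _ _
  have h₁₂ : pd1 (pd2 ψ) p = fderiv ℝ (fderiv ℝ ψ) p (1, 0) (0, 1) := happ _ _
  have h₂₂ : pd2 (pd2 ψ) p = fderiv ℝ (fderiv ℝ ψ) p (0, 1) (0, 1) := happ _ _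
  rw [h₁₁, h₁₂, h₂₂]
  nth_rw 1 [hv v, hv w]
  simp only [map_add, map_smul, add_apply, smul_apply, ← hsymm]
  module

theorem pd1_pd2_eq_pd2_pd1 (hψ : ContDiff ℝ 2 ψ) (p : ℝ × ℝ) :
    pd1 (pd2 ψ) p = pd2 (pd1 ψ) p := by
  have hd : Differentiable ℝ (fderiv ℝ ψ) :=
    (hψ.fderiv_right (m := 1) (by norm_num)).differentiable one_ne_zero
  have h : pd2 (pd1 ψ) p = fderiv ℝ (fderiv ℝ ψ) p (0, 1) (1, 0) := by
    change fderiv ℝ (fun q ↦ fderiv ℝ ψ q (1, 0)) p (0, 1) = _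
    rw [fderiv_clm_apply (hd p) (differentiableAt_const _)]
    simp
  rw [h, fderiv_fderiv_apply hψ]
  simp

open InnerProductSpace in
theorem harmonicOnNhd_comp_of_constant_coefficients (hψ : ContDiff ℝ 2 ψ) {A B C : ℝ}
    (heq : ∀ p, C • pd1 (pd1 ψ) p - (2 * B) • pd1 (pd2 ψ) p + A • pd2 (pd2 ψ) p = 0)
    (L : ℂ →L[ℝ] ℝ × ℝ) (h₁₁ : (L 1).1 ^ 2 + (L Complex.I).1 ^ 2 = C)
    (h₁₂ : (L 1).1 * (L 1).2 + (L Complex.I).1 * (L Complex.I).2 = -B)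
    (h₂₂ : (L 1).2 ^ 2 + (L Complex.I).2 ^ 2 = A) :
    HarmonicOnNhd (ψ ∘ L) Set.univ := by
  refine fun z _ ↦ ⟨(hψ.comp L.contDiff).contDiffAt, .of_forall fun z ↦ ?_⟩
  rw [laplacian_eq_iteratedFDeriv_complexPlane]
  simp only [L.iteratedFDeriv_comp_right hψ _ le_rfl,
    ContinuousMultilinearMap.compContinuousLinearMap_apply, iteratedFDeriv_two_apply,
    fderiv_fderiv_apply hψ, Pi.zero_apply]
  simp only [Matrix.cons_val_zero, Matrix.cons_val_one]
  linear_combination (norm := module) heq (L z) + h₁₁ • pd1 (pd1 ψ) (L z)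
    + (2 * h₁₂) • pd1 (pd2 ψ) (L z) + h₂₂ • pd2 (pd2 ψ) (L z)

end ConstantCoefficients

/-- Liouville's theorem for subquadratic entire solutions of a constant coefficient elliptic
equation in the plane. -/
theorem exists_eq_affine_of_constant_coefficients {ι : Type*} [Fintype ι]
    {ψ : ℝ × ℝ → EuclideanSpace ℝ ι} (hψ : ContDiff ℝ 2 ψ) {A B C : ℝ} (hC : 0 < C)
    (hdet : A * C - B ^ 2 = 1)
    (heq : ∀ p, C • pd1 (pd1 ψ) p - (2 * B) • pd1 (pd2 ψ) p + A • pd2 (pd2 ψ) p = 0)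
    {Ω ω R₀ : ℝ} (hΩ : 0 < Ω) (hω : ω < 2) (hR₀ : 0 < R₀)
    (hgrowth : ∀ R : ℝ, R₀ ≤ R → ∀ p ∈ diskR R, ‖ψ p‖ ≤ Ω * R ^ ω) :
    ∃ a b c : EuclideanSpace ℝ ι, ∀ p : ℝ × ℝ, ψ p = p.1 • a + p.2 • b + c := by
  set s := √C
  have hspos : 0 < s := Real.sqrt_pos.2 hC
  have hsq : s ^ 2 = C := Real.sq_sqrt hC.le
  let L : ℂ →L[ℝ] ℝ × ℝ :=
    (s • Complex.reCLM).prod (s⁻¹ • (Complex.imCLM - B • Complex.reCLM))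
  have hL : ∀ z, L z = (s * z.re, s⁻¹ * (z.im - B * z.re)) := fun z ↦ by simp [L]
  have hharm : InnerProductSpace.HarmonicOnNhd (ψ ∘ L) Set.univ := by
    refine harmonicOnNhd_comp_of_constant_coefficients hψ heq L ?_ ?_ ?_ <;>
      simp only [hL, Complex.one_re, Complex.one_im, Complex.I_re, Complex.I_im]
    · linear_combination hsq
    · field_simp
      ring
    · field_simp
      rw [hsq]
      linear_combination -hdet
  set M := 1 + C + 2 * (1 + B ^ 2) / C with hM
  have hM₁ : 1 ≤ M := by
    have : 0 ≤ 2 * (1 + B ^ 2) / C := by positivity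
    linarith
  have hLdisk : ∀ R, ∀ z : ℂ, ‖z‖ < R → L z ∈ diskR (M * R) := by
    intro R z hz
    have hzsq : z.re ^ 2 + z.im ^ 2 = ‖z‖ ^ 2 := by
      rw [Complex.sq_norm, Complex.normSq_apply]
      ring
    have hbound : (s * z.re) ^ 2 + (s⁻¹ * (z.im - B * z.re)) ^ 2 ≤ M * ‖z‖ ^ 2 := by
      rw [mul_pow, mul_pow, inv_pow, hsq, ← hzsq, hM]
      field_simp
      nlinarith [sq_nonneg (B * z.im + z.re), sq_nonneg z.re, sq_nonneg z.im, hC,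
        mul_nonneg hC.le (sq_nonneg z.re), mul_nonneg hC.le (sq_nonneg z.im),
        mul_nonneg (sq_nonneg C) (sq_nonneg z.im), sq_nonneg (z.im + B * z.re),
        mul_nonneg (sq_nonneg B) (sq_nonneg z.im)]
    have hlt : ‖z‖ ^ 2 < R ^ 2 := by gcongr
    rw [hL, diskR, Set.mem_ofPred_eq]
    calc _ ≤ M * ‖z‖ ^ 2 := hbound
      _ < M * R ^ 2 := by gcongr
      _ ≤ (M * R) ^ 2 := by nlinarith [mul_nonneg (sub_nonneg.2 hM₁) (sq_nonneg R)]
  have haff : ∀ k, ∃ a b c : ℝ, ∀ z : ℂ, ψ (L z) k = z.re * a + z.im * b + c := fun k ↦ by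
    refine (hharm.comp_CLM (EuclideanSpace.proj k)).exists_eq_affine_of_le
      (K := Ω * M ^ ω) (by positivity) hω hR₀ fun R hR z hz ↦ ?_
    have hRpos : 0 < R := hR₀.trans_le hR
    calc ψ (L z) k ≤ ‖ψ (L z)‖ := (le_abs_self _).trans (PiLp.norm_apply_le (ψ (L z)) k)
      _ ≤ Ω * (M * R) ^ ω := hgrowth _ (by nlinarith) _ (hLdisk R z hz)
      _ = Ω * M ^ ω * R ^ ω := by rw [Real.mul_rpow (by linarith) hRpos.le, mul_assoc]
  choose a b c habc using haff
  refine ⟨WithLp.toLp 2 fun k ↦ s⁻¹ * (a k + B * b k), WithLp.toLp 2 fun k ↦ s * b k,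
    WithLp.toLp 2 c, fun p ↦ ?_⟩
  ext k
  have hp : L ⟨s⁻¹ * p.1, s * p.2 + B * (s⁻¹ * p.1)⟩ = p := by
    rw [hL]
    ext <;> simp [hspos.ne']
  have h := habc k ⟨s⁻¹ * p.1, s * p.2 + B * (s⁻¹ * p.1)⟩
  rw [hp] at h
  simp only [PiLp.add_apply, PiLp.smul_apply, smul_eq_mul]
  rw [h]
  ring

/-- The minimal surface system of an entire graph has constant coefficients, up to normalization
by the area element. -/
theorem exists_constant_coefficients {V : Type*} [NormedAddCommGroup V] [InnerProductSpace ℝ V]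
    {ψ : ℝ × ℝ → V} (hψ : ContDiff ℝ 2 ψ)
    (hmin : ∀ p, (1 + ⟪pd2 ψ p, pd2 ψ p⟫) • pd1 (pd1 ψ) p
      - (2 * ⟪pd1 ψ p, pd2 ψ p⟫) • pd1 (pd2 ψ) p
      + (1 + ⟪pd1 ψ p, pd1 ψ p⟫) • pd2 (pd2 ψ) p = 0) :
    ∃ A B C : ℝ, 0 < C ∧ A * C - B ^ 2 = 1 ∧
      ∀ p, C • pd1 (pd1 ψ) p - (2 * B) • pd1 (pd2 ψ) p + A • pd2 (pd2 ψ) p = 0 := by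
  have hd : Differentiable ℝ (fderiv ℝ ψ) :=
    (hψ.fderiv_right (m := 1) (by norm_num)).differentiable one_ne_zero
  have hP : Differentiable ℝ (pd1 ψ) := hd.clm_apply (differentiable_const _)
  have hQ : Differentiable ℝ (pd2 ψ) := hd.clm_apply (differentiable_const _)
  have hg := metricDet_pos (pd1 ψ) (pd2 ψ)
  set W : ℝ × ℝ → ℝ := fun p ↦ √(metricDet (pd1 ψ) (pd2 ψ) p)
  have hWpos : ∀ p, 0 < W p := fun p ↦ Real.sqrt_pos.2 (hg p)
  have hWd : Differentiable ℝ W := (differentiable_metricDet hP hQ).sqrt fun p ↦ (hg p).ne'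
  set A : ℝ × ℝ → ℝ := fun p ↦ (1 + ⟪pd1 ψ p, pd1 ψ p⟫) / W p with hA
  set B : ℝ × ℝ → ℝ := fun p ↦ ⟪pd1 ψ p, pd2 ψ p⟫ / W p with hB
  set C : ℝ × ℝ → ℝ := fun p ↦ (1 + ⟪pd2 ψ p, pd2 ψ p⟫) / W p with hC
  have h₁₁ := hP.inner ℝ hP
  have h₁₂ := hP.inner ℝ hQ
  have h₂₂ := hQ.inner ℝ hQ
  have hW₀ : ∀ p, W p ≠ 0 := fun p ↦ (hWpos p).ne'
  have hAd : Differentiable ℝ A := by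
    simpa only [hA, div_eq_mul_inv] using (h₁₁.const_add 1).fun_mul (hWd.fun_inv hW₀)
  have hBd : Differentiable ℝ B := by
    simpa only [hB, div_eq_mul_inv] using h₁₂.fun_mul (hWd.fun_inv hW₀)
  have hCd : Differentiable ℝ C := by
    simpa only [hC, div_eq_mul_inv] using (h₂₂.const_add 1).fun_mul (hWd.fun_inv hW₀)
  have hApos : ∀ p, 0 < A p := fun p ↦
    div_pos (add_pos_of_pos_of_nonneg one_pos real_inner_self_nonneg) (hWpos p)
  have hCpos : ∀ p, 0 < C p := fun p ↦
    div_pos (add_pos_of_pos_of_nonneg one_pos real_inner_self_nonneg) (hWpos p)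
  have hdet : ∀ p, A p * C p - B p ^ 2 = 1 := fun p ↦ by
    have hsq : W p ^ 2 = metricDet (pd1 ψ) (pd2 ψ) p := Real.sq_sqrt (hg p).le
    have := hW₀ p
    simp only [hA, hB, hC]
    field_simp
    rw [hsq, metricDet]
  obtain ⟨F, hF⟩ := exists_potential hAd hBd fun p ↦
    pd2_div_sqrt_eq_pd1_div_sqrt hP hQ p (pd1_pd2_eq_pd2_pd1 hψ p) (hmin p)
  obtain ⟨G, hG⟩ := exists_potential hBd hCd fun p ↦
    pd2_div_sqrt_eq_pd1_div_sqrt' hP hQ p (pd1_pd2_eq_pd2_pd1 hψ p) (hmin p)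
  refine ⟨A 0, B 0, C 0, hCpos 0, hdet 0, fun p ↦ ?_⟩
  obtain ⟨hA₀, hB₀, hC₀⟩ := eq_of_gradient_rows_of_det_eq_one hAd.continuous hBd.continuous
    hCd.continuous hF hG hApos hdet 0 p
  rw [hA₀, hB₀, hC₀]
  have h := congrArg ((W p)⁻¹ • ·) (hmin p)
  simp only [smul_add, smul_sub, smul_smul, smul_zero] at h
  convert h using 4 <;> simp only [hA, hB, hC] <;> ring

/-- Bernstein–Liouville theorem: an entire `C²` solution
`ψ : ℝ² → ℝ^{n-2}` of the minimal surface system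
`h₂₂ψ_xx − 2h₁₂ψ_xy + h₁₁ψ_yy = 0` (with `h₁₁ = 1+|ψ_x|²`, `h₁₂ = ψ_x·ψ_y`,
`h₂₂ = 1+|ψ_y|²`) whose graph `X(x,y) = (x,y,ψ(x,y))` grows sub-quadratically,
`sup_{B_R}|X| ≤ Ω·R^ω` for all large `R` with `ω < 2`, is affine:
its graph represents an affine plane. -/
theorem bernstein_liouville
    (n : ℕ) (hn : 3 ≤ n)
    (ψ : ℝ × ℝ → EuclideanSpace ℝ (Fin (n - 2)))
    (hψ : ContDiff ℝ 2 ψ)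
    -- minimal surface system: h₂₂·ψ_xx − 2h₁₂·ψ_xy + h₁₁·ψ_yy = 0 in ℝ²
    (hmin : ∀ p : ℝ × ℝ,
      (1 + ‖pd2 ψ p‖ ^ 2) • pd1 (pd1 ψ) p -
        (2 * ⟪pd1 ψ p, pd2 ψ p⟫) • pd1 (pd2 ψ) p +
        (1 + ‖pd1 ψ p‖ ^ 2) • pd2 (pd2 ψ) p = 0)
    -- sub-quadratic growth of the graph `X(x,y) = (x, y, ψ(x,y))`
    (Ω ω R₀ : ℝ) (hΩ : 0 < Ω) (hω₀ : 0 ≤ ω) (hω₂ : ω < 2) (hR₀ : 0 < R₀)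
    (hgrowth : ∀ R : ℝ, R₀ ≤ R → ∀ p ∈ diskR R,
      Real.sqrt (p.1 ^ 2 + p.2 ^ 2 + ‖ψ p‖ ^ 2) ≤ Ω * R ^ ω) :
    -- then the graph represents an affine plane: `ψ` is affine
    ∃ a b c : EuclideanSpace ℝ (Fin (n - 2)),
      ∀ p : ℝ × ℝ, ψ p = p.1 • a + p.2 • b + c := by
  obtain ⟨A, B, C, hC, hdet, heq⟩ := exists_constant_coefficients hψ fun p ↦ by
    simpa only [real_inner_self_eq_norm_sq] using hmin p
  refine exists_eq_affine_of_constant_coefficients hψ hC hdet heq hΩ hω₂ hR₀ fun R hR p hp ↦ ?_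
  refine le_trans (Real.le_sqrt_of_sq_le ?_) (hgrowth R hR p hp)
  nlinarith [sq_nonneg p.1, sq_nonneg p.2]
end
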